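/- arXiv:2112.03832 — 3 statements merged into one kernel-verified Lean document; each statement's English description precedes it below -/
import Mathlib

section
/- Let n ≥ 1, w ∈ L^1_loc(ℝ^n) and δ > 0, and let w^δ be the piecewise constant δ-approximation of w on the mesh Q_δ. Then (1/(4n))·|Dw^δ|(ℝ^n) ≤ K_{2δ}(w). -/
open MeasureTheory Filter Topology ENNReal

noncomputable section

/-- The standard open cube `(0, ε)^n` in `ℝ^n`. -/
def stdCube (n : ℕ) (ε : ℝ) : Set (EuclideanSpace ℝ (Fin n)) :=
  {x | ∀ i, x i ∈ Set.Ioo (0 : ℝ) ε}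

/-- `Q ⊆ ℝ^n` is an `ε`-cube: the image of `(0,ε)^n` under a rigid motion of `ℝ^n`. -/
def IsCube (n : ℕ) (ε : ℝ) (Q : Set (EuclideanSpace ℝ (Fin n))) : Prop :=
  ∃ T : EuclideanSpace ℝ (Fin n) ≃ᵢ EuclideanSpace ℝ (Fin n), Q = T '' stdCube n ε

/-- The BMO-type energy `K_ε(f)`: the supremum, over all countable families `H` of pairwise
disjoint `ε`-cubes, of `ε^(n-1) * Σ_{Q ∈ H} ⨍_Q |f - ⨍_Q f|`, valued in `[0,∞]`. -/
def K (n : ℕ) (ε : ℝ) (f : EuclideanSpace ℝ (Fin n) → ℝ) : ℝ≥0∞ :=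
  ⨆ (H : Set (Set (EuclideanSpace ℝ (Fin n)))) (_ : H.Countable)
    (_ : ∀ Q ∈ H, IsCube n ε Q) (_ : H.Pairwise Disjoint),
    ENNReal.ofReal (ε ^ (n - 1)) *
      ∑' Q : H, ENNReal.ofReal (⨍ x in (Q : Set (EuclideanSpace ℝ (Fin n))),
        |f x - ⨍ y in (Q : Set (EuclideanSpace ℝ (Fin n))), f y|)

/-- The divergence of a vector field `φ : ℝ^n → ℝ^n`. -/
def div' {n : ℕ} (φ : EuclideanSpace ℝ (Fin n) → EuclideanSpace ℝ (Fin n))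
    (x : EuclideanSpace ℝ (Fin n)) : ℝ :=
  ∑ i, fderiv ℝ φ x (EuclideanSpace.single i 1) i

/-- The extended total variation `|Df|(ℝ^n)`, valued in `[0,∞]`. -/
def totalVariation (n : ℕ) (f : EuclideanSpace ℝ (Fin n) → ℝ) : ℝ≥0∞ :=
  ⨆ (φ : EuclideanSpace ℝ (Fin n) → EuclideanSpace ℝ (Fin n)) (_ : ContDiff ℝ 1 φ)
    (_ : HasCompactSupport φ) (_ : ∀ x, ‖φ x‖ ≤ 1),
    ENNReal.ofReal (∫ x, f x * div' φ x)

/-- The mesh `Q_δ` of open `δ`-cubes with edges parallel to the coordinate axes: the cube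
indexed by `z ∈ ℤ^n` is `(0,δ)^n + δz`. -/
def meshCube (n : ℕ) (δ : ℝ) (z : Fin n → ℤ) : Set (EuclideanSpace ℝ (Fin n)) :=
  {x | ∀ i, x i ∈ Set.Ioo (δ * (z i : ℝ)) (δ * ((z i : ℝ) + 1))}

/-- The piecewise constant `δ`-approximation `w^δ` of `w` on the mesh `Q_δ`, equal on each
cube of the mesh to the average of `w` over that cube. -/
def pcn (n : ℕ) (δ : ℝ) (w : EuclideanSpace ℝ (Fin n) → ℝ)
    (x : EuclideanSpace ℝ (Fin n)) : ℝ :=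
  ⨍ y in meshCube n δ (fun i => ⌈x i / δ⌉ - 1), w y

/-- The cube `D_R = (-R, R)^n`. -/
def DCube (n : ℕ) (R : ℝ) : Set (EuclideanSpace ℝ (Fin n)) :=
  {x | ∀ i, x i ∈ Set.Ioo (-R) R}

section CubeGeometry

variable {n : ℕ}

/-- The multi-index of the half-open mesh cell containing `x`. -/
def meshIndex (δ : ℝ) (x : EuclideanSpace ℝ (Fin n)) : Fin n → ℤ :=
  fun i => ⌈x i / δ⌉ - 1

theorem meshIndex_apply_eq_iff {δ : ℝ} (hδ : 0 < δ) (x : EuclideanSpace ℝ (Fin n)) (j : Fin n)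
    (k : ℤ) : meshIndex δ x j = k ↔ x j ∈ Set.Ioc (δ * (k : ℝ)) (δ * ((k : ℝ) + 1)) := by
  have h : meshIndex δ x j = k ↔ ⌈x j / δ⌉ = k + 1 := by
    simp only [meshIndex]
    omega
  rw [h, Int.ceil_eq_iff, lt_div_iff₀ hδ, div_le_iff₀ hδ, Set.mem_Ioc]
  push_cast
  rw [add_sub_cancel_right, mul_comm δ, mul_comm δ]

theorem meshIndex_eq_of_mem_meshCube {δ : ℝ} (hδ : 0 < δ) {x : EuclideanSpace ℝ (Fin n)}
    {z : Fin n → ℤ} (hx : x ∈ meshCube n δ z) : meshIndex δ x = z := by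
  funext j
  exact (meshIndex_apply_eq_iff hδ x j _).2 ⟨(hx j).1, (hx j).2.le⟩

theorem volume_box (I : Fin n → Set ℝ) :
    volume {x : EuclideanSpace ℝ (Fin n) | ∀ j, x j ∈ I j} = ∏ j, volume (I j) := by
  have h := (EuclideanSpace.volume_preserving_symm_measurableEquiv_toLp
    (Fin n)).measure_preimage_equiv (Set.univ.pi I)
  rw [volume_pi_pi] at h
  rw [← h]
  congr 1
  ext x
  simp

theorem measurableSet_box {I : Fin n → Set ℝ} (hI : ∀ j, MeasurableSet (I j)) :
    MeasurableSet {x : EuclideanSpace ℝ (Fin n) | ∀ j, x j ∈ I j} := by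
  rw [Set.ofPred_forall]
  refine MeasurableSet.iInter fun j => ?_
  have : Measurable fun x : EuclideanSpace ℝ (Fin n) => x j := by fun_prop
  exact this (hI j)

theorem measurableSet_meshCube (δ : ℝ) (z : Fin n → ℤ) : MeasurableSet (meshCube n δ z) :=
  measurableSet_box fun _ => measurableSet_Ioo

theorem volume_meshCube (δ : ℝ) (z : Fin n → ℤ) :
    volume (meshCube n δ z) = ENNReal.ofReal δ ^ n := by
  rw [meshCube, volume_box]
  simp [mul_add]

/-- The cube of side `2 * δ` made of the `2 ^ n` mesh cubes with multi-indices `a + {0, 1}^n`. -/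
def doubleCube (n : ℕ) (δ : ℝ) (a : Fin n → ℤ) : Set (EuclideanSpace ℝ (Fin n)) :=
  {x | ∀ i, x i ∈ Set.Ioo (δ * (a i : ℝ)) (δ * ((a i : ℝ) + 2))}

theorem volume_doubleCube (δ : ℝ) (a : Fin n → ℤ) :
    volume (doubleCube n δ a) = ENNReal.ofReal (2 * δ) ^ n := by
  rw [doubleCube, volume_box]
  simp [mul_add, mul_comm]

theorem isCube_doubleCube (δ : ℝ) (a : Fin n → ℤ) :
    IsCube n (2 * δ) (doubleCube n δ a) := by
  refine ⟨IsometryEquiv.addRight (WithLp.toLp 2 fun j => δ * (a j : ℝ)), ?_⟩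
  ext x
  constructor
  · intro hx
    refine ⟨x - WithLp.toLp 2 fun j => δ * (a j : ℝ), fun j => ?_, by simp⟩
    have h := hx j
    simp only [PiLp.sub_apply]
    constructor <;> linarith [h.1, h.2]
  · rintro ⟨y, hy, rfl⟩ j
    have h := hy j
    simp only [IsometryEquiv.addRight_apply, PiLp.add_apply]
    constructor <;> linarith [h.1, h.2]

theorem isBounded_doubleCube (δ : ℝ) (a : Fin n → ℤ) :
    Bornology.IsBounded (doubleCube n δ a) := by
  obtain ⟨T, hT⟩ := isCube_doubleCube δ a
  rw [hT]
  refine T.isometry.lipschitz.isBounded_image ?_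
  rw [isBounded_iff_forall_norm_le]
  refine ⟨Real.sqrt (∑ _i : Fin n, (2 * δ) ^ 2), fun x hx => ?_⟩
  rw [EuclideanSpace.norm_eq]
  refine Real.sqrt_le_sqrt (Finset.sum_le_sum fun i _ => ?_)
  rw [Real.norm_eq_abs, sq_abs]
  exact pow_le_pow_left₀ (hx i).1.le (hx i).2.le 2

theorem integrableOn_doubleCube {w : EuclideanSpace ℝ (Fin n) → ℝ}
    (hw : LocallyIntegrable w volume) (δ : ℝ) (a : Fin n → ℤ) :
    IntegrableOn w (doubleCube n δ a) :=
  (hw.integrableOn_isCompact (isBounded_doubleCube δ a).isCompact_closure).mono_set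
    subset_closure

theorem center_mem_doubleCube {δ : ℝ} (hδ : 0 < δ) (a : Fin n → ℤ) :
    WithLp.toLp 2 (fun j => δ * ((a j : ℝ) + 1)) ∈ doubleCube n δ a := by
  intro j
  constructor <;> dsimp only <;> nlinarith

end CubeGeometry

section Oscillation

variable {n : ℕ}

theorem enorm_average_sub_le {α : Type*} [MeasurableSpace α] {μ : Measure α} {s : Set α}
    {w : α → ℝ} (hw : IntegrableOn w s μ) (h₀ : μ s ≠ 0) (h₁ : μ s ≠ ∞) (m : ℝ) :
    ‖(⨍ x in s, w x ∂μ) - m‖ₑ ≤ (μ s)⁻¹ * ∫⁻ x in s, ‖w x - m‖ₑ ∂μ := by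
  have : (⨍ x in s, w x ∂μ) - m = ⨍ x in s, (w x - m) ∂μ := by
    rw [setAverage_eq, setAverage_eq, integral_sub hw (integrableOn_const h₁)]
    have hr : μ.real s ≠ 0 := by
      rw [Measure.real]
      exact (ENNReal.toReal_pos h₀ h₁).ne'
    simp [smul_eq_mul]
    field_simp
  rw [this, setAverage_eq, enorm_smul]
  gcongr
  · rw [enorm_inv (by rw [Measure.real]; exact (ENNReal.toReal_pos h₀ h₁).ne'),
      Measure.real, Real.enorm_eq_ofReal ENNReal.toReal_nonneg, ENNReal.ofReal_toReal h₁]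
  · exact enorm_integral_le_lintegral_enorm _

theorem ofReal_average_abs_sub {α : Type*} [MeasurableSpace α] {μ : Measure α} {s : Set α}
    {w : α → ℝ} (hw : IntegrableOn w s μ) (h₁ : μ s ≠ ∞) (m : ℝ) :
    ENNReal.ofReal (⨍ x in s, |w x - m| ∂μ) = (μ s)⁻¹ * ∫⁻ x in s, ‖w x - m‖ₑ ∂μ := by
  have hInt : IntegrableOn (fun x => w x - m) s μ := hw.sub (integrableOn_const h₁)
  rw [ofReal_setAverage hInt.abs (ae_of_all _ fun _ => abs_nonneg _), ENNReal.div_eq_inv_mul]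
  simp only [← Real.enorm_eq_ofReal_abs]

/-- The mean oscillation of `w` over a doubled mesh cube. -/
def oscDouble (n : ℕ) (δ : ℝ) (w : EuclideanSpace ℝ (Fin n) → ℝ) (a : Fin n → ℤ) : ℝ≥0∞ :=
  ENNReal.ofReal (⨍ x in doubleCube n δ a, |w x - ⨍ y in doubleCube n δ a, w y|)

theorem lintegral_doubleCube_eq {w : EuclideanSpace ℝ (Fin n) → ℝ}
    (hw : LocallyIntegrable w volume) {δ : ℝ} (hδ : 0 < δ) (a : Fin n → ℤ) :
    ∫⁻ x in doubleCube n δ a, ‖w x - ⨍ y in doubleCube n δ a, w y‖ₑ =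
      ENNReal.ofReal (2 * δ) ^ n * oscDouble n δ w a := by
  have h2 : ENNReal.ofReal (2 * δ) ^ n ≠ 0 := pow_ne_zero _ (by simpa using hδ)
  have h3 : ENNReal.ofReal (2 * δ) ^ n ≠ ∞ := by finiteness
  rw [oscDouble, ofReal_average_abs_sub (integrableOn_doubleCube hw δ a)
    (by rwa [volume_doubleCube]), volume_doubleCube, ← mul_assoc,
    ENNReal.mul_inv_cancel h2 h3, one_mul]

/-- Multi-indices with even coordinates away from `i` and `i`-th coordinate of parity `p`. -/
def parityClass (i : Fin n) (p : ℤ) : Set (Fin n → ℤ) :=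
  {a | (∀ j, j ≠ i → a j % 2 = 0) ∧ a i % 2 = p}

theorem eq_of_mem_doubleCube_of_mem_parityClass {δ : ℝ} (hδ : 0 < δ) {i : Fin n} {p : ℤ}
    {a b : Fin n → ℤ} (ha : a ∈ parityClass i p) (hb : b ∈ parityClass i p)
    {x : EuclideanSpace ℝ (Fin n)} (hxa : x ∈ doubleCube n δ a) (hxb : x ∈ doubleCube n δ b) :
    a = b := by
  funext j
  have hpar : a j % 2 = b j % 2 := by
    by_cases hj : j = i
    · subst hj
      rw [ha.2, hb.2]
    · rw [ha.1 j hj, hb.1 j hj]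
  have h₁ : (a j : ℝ) < b j + 2 := lt_of_mul_lt_mul_left ((hxa j).1.trans (hxb j).2) hδ.le
  have h₂ : (b j : ℝ) < a j + 2 := lt_of_mul_lt_mul_left ((hxb j).1.trans (hxa j).2) hδ.le
  norm_cast at h₁ h₂
  omega

theorem tsum_parityClass_le_K (w : EuclideanSpace ℝ (Fin n) → ℝ) {δ : ℝ} (hδ : 0 < δ)
    (i : Fin n) (p : ℤ) :
    ENNReal.ofReal (2 * δ) ^ (n - 1) * ∑' a : parityClass i p, oscDouble n δ w a ≤
      K n (2 * δ) w := by
  have hinj : Set.InjOn (doubleCube n δ) (parityClass i p) := by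
    intro a ha b hb hab
    exact eq_of_mem_doubleCube_of_mem_parityClass hδ ha hb (center_mem_doubleCube hδ a)
      (hab ▸ center_mem_doubleCube hδ a)
  have hsum := tsum_image (fun Q : Set (EuclideanSpace ℝ (Fin n)) =>
    ENNReal.ofReal (⨍ x in Q, |w x - ⨍ y in Q, w y|)) hinj
  have hdisj : (doubleCube n δ '' parityClass i p).Pairwise Disjoint := by
    rintro _ ⟨a, ha, rfl⟩ _ ⟨b, hb, rfl⟩ hab
    rw [Set.disjoint_left]
    intro x hxa hxb
    exact hab (congrArg _ (eq_of_mem_doubleCube_of_mem_parityClass hδ ha hb hxa hxb))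
  unfold K
  refine le_iSup_of_le (doubleCube n δ '' parityClass i p) <|
    le_iSup_of_le ((Set.to_countable _).image _) <|
    le_iSup_of_le ?_ <| le_iSup_of_le hdisj ?_
  · rintro _ ⟨a, -, rfl⟩
    exact isCube_doubleCube δ a
  · rw [hsum, ENNReal.ofReal_pow (by positivity)]
    rfl

/-- The base of the doubled cube containing both mesh cubes `z` and `z - e_i`. -/
def pairBase (i : Fin n) (z : Fin n → ℤ) : Fin n → ℤ :=
  fun j => if j = i then z j - 1 else 2 * (z j / 2)

/-- The two mesh cubes adjacent along the lower face of the cube `z` in direction `i`. -/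
def pairCube (δ : ℝ) (i : Fin n) (z : Fin n → ℤ) : Set (EuclideanSpace ℝ (Fin n)) :=
  meshCube n δ z ∪ meshCube n δ (z - Pi.single i 1)

theorem disjoint_meshCube {δ : ℝ} (hδ : 0 < δ) {z z' : Fin n → ℤ} (h : z ≠ z') :
    Disjoint (meshCube n δ z) (meshCube n δ z') := by
  rw [Set.disjoint_left]
  intro x hx hx'
  exact h ((meshIndex_eq_of_mem_meshCube hδ hx).symm.trans (meshIndex_eq_of_mem_meshCube hδ hx'))

theorem ne_sub_single (i : Fin n) (z : Fin n → ℤ) : z ≠ z - Pi.single i 1 := by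
  intro h
  have := congrFun h i
  simp at this
  omega

theorem pairBase_mem (i : Fin n) (z : Fin n → ℤ) :
    pairBase i z ∈ parityClass i 0 ∪ parityClass i 1 := by
  have h : ∀ j, j ≠ i → pairBase i z j % 2 = 0 := by
    intro j hj
    simp [pairBase, hj]
  rcases Int.emod_two_eq_zero_or_one (pairBase i z i) with h' | h'
  · exact Or.inl ⟨h, h'⟩
  · exact Or.inr ⟨h, h'⟩

theorem meshCube_subset_doubleCube {δ : ℝ} (hδ : 0 < δ) {z a : Fin n → ℤ}
    (h : ∀ j, a j ≤ z j ∧ z j ≤ a j + 1) : meshCube n δ z ⊆ doubleCube n δ a := by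
  intro x hx j
  have h₁ : (a j : ℝ) ≤ z j := by exact_mod_cast (h j).1
  have h₂ : (z j : ℝ) ≤ a j + 1 := by exact_mod_cast (h j).2
  constructor
  · exact (mul_le_mul_of_nonneg_left h₁ hδ.le).trans_lt (hx j).1
  · exact (hx j).2.trans_le (mul_le_mul_of_nonneg_left (by linarith) hδ.le)

theorem meshCube_subset_pairBase {δ : ℝ} (hδ : 0 < δ) (i : Fin n) (z : Fin n → ℤ) :
    meshCube n δ z ⊆ doubleCube n δ (pairBase i z) := by
  refine meshCube_subset_doubleCube hδ fun j => ?_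
  by_cases hj : j = i <;> simp only [pairBase, hj, if_true, if_false] <;> omega

theorem meshCube_sub_single_subset_pairBase {δ : ℝ} (hδ : 0 < δ) (i : Fin n) (z : Fin n → ℤ) :
    meshCube n δ (z - Pi.single i 1) ⊆ doubleCube n δ (pairBase i z) := by
  refine meshCube_subset_doubleCube hδ fun j => ?_
  by_cases hj : j = i
  · subst hj
    simp [pairBase]
  · simp only [pairBase, hj, if_false, Pi.sub_apply, Pi.single_eq_of_ne hj]
    omega

theorem pairCube_pairwise_disjoint {δ : ℝ} (hδ : 0 < δ) (i : Fin n) (a : Fin n → ℤ) :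
    Pairwise (Function.onFun Disjoint
      fun z : pairBase i ⁻¹' {a} => pairCube δ i (z : Fin n → ℤ)) := by
  rintro ⟨z, hz⟩ ⟨z', hz'⟩ hne
  have hzz : z i = z' i := by
    have := congrFun ((show pairBase i z = a from hz).trans
      (show pairBase i z' = a from hz').symm) i
    simpa [pairBase] using this
  have hne' : z ≠ z' := fun h => hne (Subtype.ext h)
  have h₁ : z ≠ z' - Pi.single i 1 := by
    intro h
    have := congrFun h i
    simp at this
    omega
  have h₂ : z - Pi.single i 1 ≠ z' := by
    intro h
    have := congrFun h i
    simp at this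
    omega
  have h₃ : z - Pi.single i 1 ≠ z' - Pi.single i 1 := fun h => hne' (sub_left_injective h)
  simp only [Function.onFun, pairCube, Set.disjoint_union_left, Set.disjoint_union_right]
  exact ⟨⟨disjoint_meshCube hδ hne', disjoint_meshCube hδ h₂⟩,
    disjoint_meshCube hδ h₁, disjoint_meshCube hδ h₃⟩

/-- The jump of the mesh averages of `w` across the lower face of the cube `z` in direction `i`. -/
def meshJump (n : ℕ) (δ : ℝ) (w : EuclideanSpace ℝ (Fin n) → ℝ) (i : Fin n) (z : Fin n → ℤ) :
    ℝ≥0∞ :=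
  ‖(⨍ y in meshCube n δ (z - Pi.single i 1), w y) - ⨍ y in meshCube n δ z, w y‖ₑ

theorem meshJump_le {w : EuclideanSpace ℝ (Fin n) → ℝ} (hw : LocallyIntegrable w volume)
    {δ : ℝ} (hδ : 0 < δ) (i : Fin n) (z : Fin n → ℤ) (m : ℝ) :
    meshJump n δ w i z ≤ (ENNReal.ofReal δ ^ n)⁻¹ * ∫⁻ x in pairCube δ i z, ‖w x - m‖ₑ := by
  have h₀ : ∀ z : Fin n → ℤ, volume (meshCube n δ z) ≠ 0 := fun z => by
    rw [volume_meshCube]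
    exact pow_ne_zero _ (by simpa using hδ)
  have h₁ : ∀ z : Fin n → ℤ, volume (meshCube n δ z) ≠ ∞ := fun z => by
    rw [volume_meshCube]
    finiteness
  have hz := enorm_average_sub_le ((integrableOn_doubleCube hw δ _).mono_set
    (meshCube_subset_pairBase hδ i z)) (h₀ _) (h₁ _) m
  have hz' := enorm_average_sub_le ((integrableOn_doubleCube hw δ _).mono_set
    (meshCube_sub_single_subset_pairBase hδ i z)) (h₀ _) (h₁ _) m
  rw [volume_meshCube] at hz hz'
  rw [pairCube, lintegral_union (measurableSet_meshCube _ _)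
    (disjoint_meshCube hδ (ne_sub_single i z)), mul_add, add_comm, meshJump]
  calc _ = ‖((⨍ y in meshCube n δ (z - Pi.single i 1), w y) - m)
            - ((⨍ y in meshCube n δ z, w y) - m)‖ₑ := by rw [sub_sub_sub_cancel_right]
    _ ≤ _ := enorm_sub_le
    _ ≤ _ := add_le_add hz' hz

theorem tsum_fiber_meshJump_le {w : EuclideanSpace ℝ (Fin n) → ℝ}
    (hw : LocallyIntegrable w volume) {δ : ℝ} (hδ : 0 < δ) (i : Fin n) (a : Fin n → ℤ) :
    ∑' z : pairBase i ⁻¹' {a}, meshJump n δ w i z ≤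
      (ENNReal.ofReal δ ^ n)⁻¹ * (ENNReal.ofReal (2 * δ) ^ n * oscDouble n δ w a) := by
  rw [← lintegral_doubleCube_eq hw hδ]
  set m := ⨍ y in doubleCube n δ a, w y
  calc _ ≤ ∑' z : pairBase i ⁻¹' {a},
          (ENNReal.ofReal δ ^ n)⁻¹ * ∫⁻ x in pairCube δ i (z : Fin n → ℤ), ‖w x - m‖ₑ :=
        ENNReal.tsum_le_tsum fun z => meshJump_le hw hδ i z m
    _ = (ENNReal.ofReal δ ^ n)⁻¹ *
          ∫⁻ x in ⋃ z : pairBase i ⁻¹' {a}, pairCube δ i (z : Fin n → ℤ), ‖w x - m‖ₑ := by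
        rw [ENNReal.tsum_mul_left, lintegral_iUnion (fun z : pairBase i ⁻¹' {a} =>
          show MeasurableSet (pairCube δ i (z : Fin n → ℤ)) from
            (measurableSet_meshCube _ _).union (measurableSet_meshCube _ _))
          (pairCube_pairwise_disjoint hδ i a)]
    _ ≤ _ := by
        gcongr
        refine Set.iUnion_subset ?_
        rintro ⟨z, rfl⟩
        exact Set.union_subset (meshCube_subset_pairBase hδ i z)
          (meshCube_sub_single_subset_pairBase hδ i z)

theorem tsum_meshJump_le {w : EuclideanSpace ℝ (Fin n) → ℝ}
    (hw : LocallyIntegrable w volume) {δ : ℝ} (hδ : 0 < δ) (i : Fin n) :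
    ENNReal.ofReal δ ^ (n - 1) * ∑' z, meshJump n δ w i z ≤ 4 * K n (2 * δ) w := by
  have hn : n = (n - 1) + 1 := by have := i.pos; omega
  set d := ENNReal.ofReal δ with hd
  have hd0 : d ≠ 0 := by simpa [hd] using hδ
  have hdt : d ≠ ∞ := ENNReal.ofReal_ne_top
  have h2d : ENNReal.ofReal (2 * δ) = 2 * d := by
    rw [ENNReal.ofReal_mul (by norm_num)]
    simp [hd]
  have hconst : d ^ (n - 1) * ((d ^ n)⁻¹ * (2 * d) ^ n) = 2 * (2 * d) ^ (n - 1) := by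
    have h1 : d ^ n ≠ 0 := pow_ne_zero _ hd0
    have h2 : d ^ n ≠ ∞ := by finiteness
    rw [mul_pow 2 d n, mul_left_comm (d ^ n)⁻¹, ENNReal.inv_mul_cancel h1 h2, mul_one, mul_pow]
    conv_lhs => rw [hn]
    simp only [add_tsub_cancel_right]
    ring
  set S := parityClass i 0 ∪ parityClass i 1
  have hsupp : ∑' a, ∑' z : pairBase i ⁻¹' {a}, meshJump n δ w i z =
      ∑' a : S, ∑' z : pairBase i ⁻¹' {(a : Fin n → ℤ)}, meshJump n δ w i z := by
    refine (tsum_subtype_eq_of_support_subset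
      (f := fun a => ∑' z : pairBase i ⁻¹' {a}, meshJump n δ w i z) fun a ha => ?_).symm
    by_contra haS
    refine ha ?_
    have : IsEmpty (pairBase i ⁻¹' {a}) := by
      refine ⟨?_⟩
      rintro ⟨z, rfl⟩
      exact haS (pairBase_mem i z)
    exact tsum_empty
  rw [← ENNReal.tsum_fiberwise _ (pairBase i), hsupp]
  calc _ ≤ d ^ (n - 1) * ∑' a : S, (d ^ n)⁻¹ * ((2 * d) ^ n * oscDouble n δ w a) := by
        gcongr with a
        exact h2d ▸ tsum_fiber_meshJump_le hw hδ i a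
    _ = d ^ (n - 1) * ((d ^ n)⁻¹ * (2 * d) ^ n) * ∑' a : S, oscDouble n δ w a := by
        rw [ENNReal.tsum_mul_left, ENNReal.tsum_mul_left]
        ring
    _ ≤ 2 * (2 * d) ^ (n - 1) * (∑' a : parityClass i 0, oscDouble n δ w a +
          ∑' a : parityClass i 1, oscDouble n δ w a) := by
        rw [hconst]
        gcongr
        exact ENNReal.tsum_union_le (oscDouble n δ w) _ _
    _ = 2 * ((2 * d) ^ (n - 1) * ∑' a : parityClass i 0, oscDouble n δ w a +
          (2 * d) ^ (n - 1) * ∑' a : parityClass i 1, oscDouble n δ w a) := by ring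
    _ ≤ 2 * (K n (2 * δ) w + K n (2 * δ) w) := by
        rw [← h2d]
        gcongr <;> exact tsum_parityClass_le_K w hδ i _
    _ = 4 * K n (2 * δ) w := by ring

end Oscillation

section Variation

variable {n : ℕ}

theorem measurable_meshIndex (δ : ℝ) :
    Measurable (meshIndex δ : EuclideanSpace ℝ (Fin n) → Fin n → ℤ) := by
  refine measurable_pi_lambda _ fun j => ?_
  have h : Measurable fun x : EuclideanSpace ℝ (Fin n) => ⌈x j / δ⌉ := by fun_prop
  exact (Measurable.of_discrete (f := fun k : ℤ => k - 1)).comp h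

theorem measurable_pcn (δ : ℝ) (w : EuclideanSpace ℝ (Fin n) → ℝ) : Measurable (pcn n δ w) :=
  (Measurable.of_discrete (f := fun z : Fin n → ℤ => ⨍ y in meshCube n δ z, w y)).comp
    (measurable_meshIndex δ)

theorem locallyIntegrable_pcn {δ : ℝ} (hδ : 0 < δ) (w : EuclideanSpace ℝ (Fin n) → ℝ) :
    LocallyIntegrable (pcn n δ w) volume := by
  rw [locallyIntegrable_iff]
  intro k hk
  obtain ⟨R, hR⟩ := isBounded_iff_forall_norm_le.1 hk.isBounded
  set F : Set (Fin n → ℤ) := Set.Icc (fun _ => ⌈-R / δ⌉ - 1) (fun _ => ⌈R / δ⌉ - 1)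
  obtain ⟨C, hC⟩ := ((Set.finite_Icc _ _ : F.Finite).image
    fun z => ‖⨍ y in meshCube n δ z, w y‖).bddAbove
  refine Measure.integrableOn_of_bounded hk.measure_lt_top.ne
    (measurable_pcn δ w).aestronglyMeasurable (M := C) ?_
  refine (ae_restrict_iff' hk.measurableSet).2 (ae_of_all _ fun x hx => ?_)
  refine hC ⟨meshIndex δ x, ?_, rfl⟩
  have hj : ∀ j, |x j| ≤ R := fun j => (PiLp.norm_apply_le x j).trans (hR x hx)
  constructor <;> intro j <;> refine sub_le_sub_right (Int.ceil_mono ?_) 1 <;> gcongr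
  · exact (abs_le.1 (hj j)).1
  · exact (abs_le.1 (hj j)).2

/-- The points of the mesh cell `z` at distance at most `h` from its lower face in
direction `i`. -/
def faceSlab (δ : ℝ) (i : Fin n) (h : ℝ) (z : Fin n → ℤ) : Set (EuclideanSpace ℝ (Fin n)) :=
  {x | ∀ j, x j ∈ Set.Ioc (δ * (z j : ℝ)) (δ * (z j : ℝ) + if j = i then h else δ)}

theorem volume_faceSlab (δ : ℝ) (i : Fin n) (h : ℝ) (z : Fin n → ℤ) :
    volume (faceSlab δ i h z) = ENNReal.ofReal h * ENNReal.ofReal δ ^ (n - 1) := by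
  rw [faceSlab, volume_box, ← Finset.mul_prod_erase _ _ (Finset.mem_univ i)]
  congr 1
  · simp
  · rw [Finset.prod_congr rfl (g := fun _ => ENNReal.ofReal δ)]
    · simp
    · intro j hj
      simp [Finset.ne_of_mem_erase hj]

theorem measurableSet_faceSlab (δ : ℝ) (i : Fin n) (h : ℝ) (z : Fin n → ℤ) :
    MeasurableSet (faceSlab δ i h z) :=
  measurableSet_box fun _ => measurableSet_Ioc

theorem enorm_pcn_sub_le {δ : ℝ} (hδ : 0 < δ) (w : EuclideanSpace ℝ (Fin n) → ℝ) (i : Fin n)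
    {h : ℝ} (h₀ : 0 < h) (hh : h < δ) (x : EuclideanSpace ℝ (Fin n)) :
    ‖pcn n δ w (x - h • EuclideanSpace.single i 1) - pcn n δ w x‖ₑ ≤
      ∑' z, (faceSlab δ i h z).indicator (fun _ => meshJump n δ w i z) x := by
  set x' := x - h • EuclideanSpace.single i (1 : ℝ) with hx'
  have hx'i : x' i = x i - h := by simp [hx']
  have hx'j : ∀ j, j ≠ i → x' j = x j := fun j hj => by simp [hx', hj]
  have hidx : ∀ j, j ≠ i → meshIndex δ x' j = meshIndex δ x j := fun j hj => by
    simp only [meshIndex, hx'j j hj]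
  have hmem := fun j => (meshIndex_apply_eq_iff hδ x j _).1 rfl
  have hpcn : ∀ y, pcn n δ w y = ⨍ u in meshCube n δ (meshIndex δ y), w u := fun _ => rfl
  by_cases hcase : δ * (meshIndex δ x i : ℝ) < x i - h
  · have : meshIndex δ x' = meshIndex δ x := by
      funext j
      by_cases hj : j = i
      · subst hj
        rw [meshIndex_apply_eq_iff hδ, hx'i]
        exact ⟨hcase, by linarith [(hmem j).2]⟩
      · exact hidx j hj
    rw [hpcn, hpcn, this]
    simp
  · push Not at hcase
    have : meshIndex δ x' = meshIndex δ x - Pi.single i 1 := by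
      funext j
      by_cases hj : j = i
      · subst hj
        rw [meshIndex_apply_eq_iff hδ, hx'i]
        have := (hmem j).1
        constructor <;> simp <;> linarith
      · simp [hidx j hj, hj]
    have hslab : x ∈ faceSlab δ i h (meshIndex δ x) := by
      intro j
      refine ⟨(hmem j).1, ?_⟩
      split_ifs with hj
      · subst hj
        linarith
      · linarith [(hmem j).2]
    calc _ = (faceSlab δ i h (meshIndex δ x)).indicator
            (fun _ => meshJump n δ w i (meshIndex δ x)) x := by
          rw [Set.indicator_of_mem hslab, hpcn, hpcn, this, meshJump]
      _ ≤ _ := ENNReal.le_tsum (f := fun z =>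
          (faceSlab δ i h z).indicator (fun _ => meshJump n δ w i z) x) (meshIndex δ x)

theorem lintegral_enorm_pcn_sub_le {δ : ℝ} (hδ : 0 < δ) (w : EuclideanSpace ℝ (Fin n) → ℝ)
    (i : Fin n) {h : ℝ} (h₀ : 0 < h) (hh : h < δ) :
    ∫⁻ x, ‖pcn n δ w (x - h • EuclideanSpace.single i 1) - pcn n δ w x‖ₑ ≤
      ENNReal.ofReal h * (ENNReal.ofReal δ ^ (n - 1) * ∑' z, meshJump n δ w i z) := by
  calc _ ≤ ∫⁻ x, ∑' z, (faceSlab δ i h z).indicator (fun _ => meshJump n δ w i z) x :=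
        lintegral_mono fun x => enorm_pcn_sub_le hδ w i h₀ hh x
    _ = ∑' z, meshJump n δ w i z * (ENNReal.ofReal h * ENNReal.ofReal δ ^ (n - 1)) := by
        rw [lintegral_tsum fun z =>
          (measurable_const.indicator (measurableSet_faceSlab δ i h z)).aemeasurable]
        refine tsum_congr fun z => ?_
        rw [lintegral_indicator_const (measurableSet_faceSlab δ i h z), volume_faceSlab]
    _ = _ := by
        rw [ENNReal.tsum_mul_right]
        ring

theorem integral_translate_sub_mul {f ψ : EuclideanSpace ℝ (Fin n) → ℝ}
    (hf : LocallyIntegrable f volume) (hψ : Continuous ψ) (hψc : HasCompactSupport ψ)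
    (v : EuclideanSpace ℝ (Fin n)) :
    ∫ x, (ψ (x + v) - ψ x) * f x = ∫ x, ψ x * (f (x - v) - f x) := by
  have hInt : Integrable fun x => ψ x * f x :=
    hf.integrable_smul_left_of_hasCompactSupport hψ hψc
  have hInt' : Integrable fun x => ψ (x + v) * f x :=
    hf.integrable_smul_left_of_hasCompactSupport (hψ.comp (continuous_add_const v))
      (hψc.comp_homeomorph (Homeomorph.addRight v))
  have hInt'' : Integrable fun x => ψ x * f (x - v) := by
    simpa using hInt'.comp_sub_right v
  have heq : ∫ x, ψ (x + v) * f x = ∫ x, ψ x * f (x - v) := by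
    rw [← integral_add_right_eq_self (fun x => ψ x * f (x - v)) v]
    simp
  simp only [sub_mul, mul_sub]
  rw [integral_sub hInt' hInt, integral_sub hInt'' hInt, heq]

theorem tendsto_integral_difference_quotient {f ψ : EuclideanSpace ℝ (Fin n) → ℝ}
    (hf : LocallyIntegrable f volume) (hψ : ContDiff ℝ 1 ψ) (hψc : HasCompactSupport ψ)
    (v : EuclideanSpace ℝ (Fin n)) :
    Tendsto (fun t : ℝ => t⁻¹ * ∫ x, (ψ (x + t • v) - ψ x) * f x) (𝓝[>] 0)
      (𝓝 (∫ x, f x * fderiv ℝ ψ x v)) := by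
  obtain ⟨C, hC⟩ := hψ.lipschitzWith_of_hasCompactSupport hψc one_ne_zero
  set B := Metric.cthickening ‖v‖ (tsupport ψ)
  have hBc : IsCompact B := hψc.isCompact.cthickening
  have hB : tsupport ψ ⊆ B := Metric.self_subset_cthickening _
  have hg : Integrable (B.indicator f) volume :=
    (integrable_indicator_iff hBc.measurableSet).2 (hf.integrableOn_isCompact hBc)
  have hlim := hC.integral_inv_smul_sub_mul_tendsto_integral_lineDeriv_mul hg v
  have hval : ∫ x, lineDeriv ℝ ψ x v * B.indicator f x = ∫ x, f x * fderiv ℝ ψ x v := by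
    refine integral_congr_ae (ae_of_all _ fun x => ?_)
    have hd : lineDeriv ℝ ψ x v = fderiv ℝ ψ x v :=
      ((hψ.differentiable one_ne_zero) x).lineDeriv_eq_fderiv
    by_cases hx : x ∈ B
    · simp [hx, hd, mul_comm]
    · have : fderiv ℝ ψ x = 0 := by
        by_contra hne
        exact hx (hB (support_fderiv_subset ℝ hne))
      simp [hx, this]
  rw [hval] at hlim
  refine hlim.congr' ?_
  filter_upwards [Ioo_mem_nhdsGT (zero_lt_one (α := ℝ))] with t ht
  rw [← integral_const_mul]
  refine integral_congr_ae (ae_of_all _ fun x => ?_)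
  by_cases hx : x ∈ B
  · simp [hx, mul_assoc]
  · have h₁ : ψ x = 0 := image_eq_zero_of_notMem_tsupport fun h => hx (hB h)
    have h₂ : ψ (x + t • v) = 0 := by
      refine image_eq_zero_of_notMem_tsupport fun h => hx ?_
      refine Metric.mem_cthickening_of_dist_le x _ _ _ h ?_
      rw [dist_self_add_right, norm_smul, Real.norm_of_nonneg ht.1.le]
      exact mul_le_of_le_one_left (norm_nonneg _) ht.2.le
    simp [hx, h₁, h₂]

theorem ofReal_integral_pcn_mul_fderiv_le {δ : ℝ} (hδ : 0 < δ)
    (w : EuclideanSpace ℝ (Fin n) → ℝ) (i : Fin n) {ψ : EuclideanSpace ℝ (Fin n) → ℝ}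
    (hψ : ContDiff ℝ 1 ψ) (hψc : HasCompactSupport ψ) (hψ1 : ∀ x, ‖ψ x‖ ≤ 1) :
    ENNReal.ofReal (∫ x, pcn n δ w x * fderiv ℝ ψ x (EuclideanSpace.single i 1)) ≤
      ENNReal.ofReal δ ^ (n - 1) * ∑' z, meshJump n δ w i z := by
  have hf := locallyIntegrable_pcn hδ w
  refine le_of_tendsto ((ENNReal.continuous_ofReal.tendsto _).comp
    (tendsto_integral_difference_quotient hf hψ hψc (EuclideanSpace.single i 1))) ?_
  filter_upwards [Ioo_mem_nhdsGT hδ] with t ht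
  have ht0 : ENNReal.ofReal t ≠ 0 := by simpa using ht.1
  simp only [Function.comp_apply]
  rw [integral_translate_sub_mul hf hψ.continuous hψc,
    ENNReal.ofReal_mul (inv_nonneg.2 ht.1.le), ENNReal.ofReal_inv_of_pos ht.1]
  calc _ ≤ (ENNReal.ofReal t)⁻¹ *
        ∫⁻ x, ‖pcn n δ w (x - t • EuclideanSpace.single i 1) - pcn n δ w x‖ₑ := by
        gcongr
        refine (Real.ofReal_le_enorm _).trans
          ((enorm_integral_le_lintegral_enorm _).trans (lintegral_mono fun x => ?_))
        rw [enorm_mul]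
        refine mul_le_of_le_one_left zero_le ?_
        rw [← ofReal_norm]
        exact ENNReal.ofReal_le_one.2 (hψ1 x)
    _ ≤ (ENNReal.ofReal t)⁻¹ * (ENNReal.ofReal t *
          (ENNReal.ofReal δ ^ (n - 1) * ∑' z, meshJump n δ w i z)) := by
        gcongr
        exact lintegral_enorm_pcn_sub_le hδ w i ht.1 ht.2
    _ = _ := by
        rw [← mul_assoc, ENNReal.inv_mul_cancel ht0 ENNReal.ofReal_ne_top, one_mul]

theorem totalVariation_pcn_le {δ : ℝ} (hδ : 0 < δ) (w : EuclideanSpace ℝ (Fin n) → ℝ) :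
    totalVariation n (pcn n δ w) ≤
      ∑ i, ENNReal.ofReal δ ^ (n - 1) * ∑' z, meshJump n δ w i z := by
  refine iSup_le fun φ => iSup_le fun hφ => iSup_le fun hφc => iSup_le fun hφ1 => ?_
  have hcomp : ∀ i, ContDiff ℝ 1 fun x => φ x i := fun i => by fun_prop
  have hcompc : ∀ i, HasCompactSupport fun x => φ x i := fun i =>
    hφc.comp_left (g := fun v : EuclideanSpace ℝ (Fin n) => v i) (by simp)
  have hderiv : ∀ i x v, fderiv ℝ φ x v i = fderiv ℝ (fun y => φ y i) x v := fun i x v => by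
    have h := (EuclideanSpace.proj i : EuclideanSpace ℝ (Fin n) →L[ℝ] ℝ).hasFDerivAt.comp x
      ((hφ.differentiable one_ne_zero) x).hasFDerivAt
    have h' : HasFDerivAt (fun y => φ y i) _ x := h
    rw [h'.fderiv]
    simp
  have hInt : ∀ i, Integrable fun x =>
      pcn n δ w x * fderiv ℝ (fun y => φ y i) x (EuclideanSpace.single i 1) := fun i =>
    (locallyIntegrable_pcn hδ w).integrable_smul_right_of_hasCompactSupport
      (((hcomp i).continuous_fderiv one_ne_zero).clm_apply continuous_const)
      ((hcompc i).fderiv_apply ℝ _)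
  simp only [div', Finset.mul_sum, hderiv]
  rw [integral_finsetSum _ fun i _ => hInt i]
  refine (Finset.le_sum_of_subadditive ENNReal.ofReal ENNReal.ofReal_zero.le
    (fun _ _ => ENNReal.ofReal_add_le) _ _).trans (Finset.sum_le_sum fun i _ => ?_)
  exact ofReal_integral_pcn_mul_fderiv_le hδ w i (hcomp i) (hcompc i)
    fun x => (PiLp.norm_apply_le (φ x) i).trans (hφ1 x)

end Variation

/-- `(1/(4n))·|Dw^δ|(ℝ^n) ≤ K_{2δ}(w)`. -/
theorem stmt11 (n : ℕ) (hn : 1 ≤ n) (w : EuclideanSpace ℝ (Fin n) → ℝ)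
    (hw : LocallyIntegrable w volume) (δ : ℝ) (hδ : 0 < δ) :
    totalVariation n (pcn n δ w) / (4 * (n : ℝ≥0∞)) ≤ K n (2 * δ) w := by
  have hn0 : (n : ℝ≥0∞) ≠ 0 := by
    norm_cast
    omega
  rw [ENNReal.div_le_iff (mul_ne_zero (by norm_num) hn0) (by finiteness)]
  calc totalVariation n (pcn n δ w)
      ≤ ∑ i, ENNReal.ofReal δ ^ (n - 1) * ∑' z, meshJump n δ w i z := totalVariation_pcn_le hδ w
    _ ≤ ∑ _i : Fin n, 4 * K n (2 * δ) w := Finset.sum_le_sum fun i _ => tsum_meshJump_le hw hδ i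
    _ = K n (2 * δ) w * (4 * n) := by
        rw [Finset.sum_const, Finset.card_univ, Fintype.card_fin, nsmul_eq_mul]
        ring
end
end

section
/- Let n ≥ 1, w ∈ L^1_loc(ℝ^n) and δ > 0. Then ‖w − w^{δ/2}‖_{L^1(ℝ^n)} ≤ (1 + 2^n)·‖w − w^δ‖_{L^1(ℝ^n)} (an inequality in [0,∞]), where w^δ and w^{δ/2} are the piecewise constant approximations of w on the meshes Q_δ and Q_{δ/2} respectively. -/
open MeasureTheory Filter Topology ENNReal

noncomputable section

/-- Replacing a constant by the mean at most doubles the `L^1` deviation. -/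
theorem lintegral_enorm_sub_average_le {α : Type*} [MeasurableSpace α] {μ : Measure α}
    [IsFiniteMeasure μ] {f : α → ℝ} (hf : Integrable f μ) (c : ℝ) :
    ∫⁻ x, ‖f x - ⨍ y, f y ∂μ‖ₑ ∂μ ≤ 2 * ∫⁻ x, ‖f x - c‖ₑ ∂μ := by
  set a := ⨍ y, f y ∂μ with ha
  have hmean : ∫ x, (f x - c) ∂μ = μ.real Set.univ * (a - c) := by
    rw [integral_sub hf (integrable_const c), ← measure_smul_average μ f, integral_const]
    simp only [smul_eq_mul, ← ha]
    ring
  have hconst : ∫⁻ _, ‖c - a‖ₑ ∂μ ≤ ∫⁻ x, ‖f x - c‖ₑ ∂μ := by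
    calc ∫⁻ _, ‖c - a‖ₑ ∂μ = ‖∫ x, (f x - c) ∂μ‖ₑ := by
          rw [hmean, enorm_mul, lintegral_const, mul_comm, ← neg_sub a c, enorm_neg,
            Real.enorm_of_nonneg measureReal_nonneg, ofReal_measureReal]
      _ ≤ _ := enorm_integral_le_lintegral_enorm _
  calc ∫⁻ x, ‖f x - a‖ₑ ∂μ ≤ ∫⁻ x, (‖f x - c‖ₑ + ‖c - a‖ₑ) ∂μ := by
        refine lintegral_mono fun x => ?_
        rw [← sub_add_sub_cancel (f x) c a]
        exact enorm_add_le _ _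
    _ = ∫⁻ x, ‖f x - c‖ₑ ∂μ + ∫⁻ _, ‖c - a‖ₑ ∂μ := lintegral_add_right _ measurable_const
    _ ≤ 2 * ∫⁻ x, ‖f x - c‖ₑ ∂μ := by
        rw [two_mul]
        gcongr

/-- The half-open version of `meshCube`; these cells partition `ℝ^n`. -/
def meshCell (n : ℕ) (δ : ℝ) (z : Fin n → ℤ) : Set (EuclideanSpace ℝ (Fin n)) :=
  {x | ∀ i, x i ∈ Set.Ioc (δ * (z i : ℝ)) (δ * ((z i : ℝ) + 1))}

theorem mem_meshCell_iff {n : ℕ} {δ : ℝ} (hδ : 0 < δ) {z : Fin n → ℤ}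
    {x : EuclideanSpace ℝ (Fin n)} :
    x ∈ meshCell n δ z ↔ (fun i => ⌈x i / δ⌉ - 1) = z := by
  rw [funext_iff]
  refine forall_congr' fun i => ?_
  rw [sub_eq_iff_eq_add, Int.ceil_eq_iff, lt_div_iff₀ hδ, div_le_iff₀ hδ, Set.mem_Ioc]
  push_cast
  rw [add_sub_cancel_right, mul_comm δ, mul_comm δ]

theorem measurableSet_meshCell (n : ℕ) (δ : ℝ) (z : Fin n → ℤ) :
    MeasurableSet (meshCell n δ z) := by
  simp only [meshCell, Set.ofPred_forall]
  refine MeasurableSet.iInter fun i => ?_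
  exact measurableSet_Ioc.preimage
    (by fun_prop : Measurable fun x : EuclideanSpace ℝ (Fin n) => x i)

theorem meshCube_ae_eq_meshCell (n : ℕ) (δ : ℝ) (z : Fin n → ℤ) :
    meshCube n δ z =ᵐ[volume] meshCell n δ z := by
  have h := (PiLp.volume_preserving_ofLp (Fin n)).quasiMeasurePreserving.preimage_ae_eq
    (Measure.pi_Ioo_ae_eq_pi_Ioc (μ := fun _ : Fin n => (volume : Measure ℝ)) (s := Set.univ)
      (f := fun i => δ * (z i : ℝ)) (g := fun i => δ * ((z i : ℝ) + 1)))
  have hcube : meshCube n δ z = WithLp.ofLp ⁻¹'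
      Set.univ.pi fun i => Set.Ioo (δ * (z i : ℝ)) (δ * ((z i : ℝ) + 1)) := by
    ext x
    simp [meshCube, Set.mem_pi]
  have hcell : meshCell n δ z = WithLp.ofLp ⁻¹'
      Set.univ.pi fun i => Set.Ioc (δ * (z i : ℝ)) (δ * ((z i : ℝ) + 1)) := by
    ext x
    simp [meshCell, Set.mem_pi]
  rw [hcube, hcell]
  exact h

theorem exists_isCompact_meshCell_subset (n : ℕ) (δ : ℝ) (z : Fin n → ℤ) :
    ∃ k, IsCompact k ∧ meshCell n δ z ⊆ k := by
  refine ⟨WithLp.ofLp ⁻¹' Set.Icc (fun i => δ * (z i : ℝ)) (fun i => δ * ((z i : ℝ) + 1)), ?_,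
    fun x hx => ⟨fun i => (hx i).1.le, fun i => (hx i).2⟩⟩
  exact (PiLp.homeomorph 2 fun _ : Fin n => ℝ).isCompact_preimage.2 isCompact_Icc

theorem lintegral_eq_tsum_meshCell {n : ℕ} {δ : ℝ} (hδ : 0 < δ)
    (f : EuclideanSpace ℝ (Fin n) → ℝ≥0∞) :
    ∫⁻ x, f x = ∑' z, ∫⁻ x in meshCell n δ z, f x := by
  rw [← lintegral_iUnion (measurableSet_meshCell n δ), Set.iUnion_eq_univ_iff.2,
    setLIntegral_univ]
  · exact fun x => ⟨_, (mem_meshCell_iff hδ).2 rfl⟩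
  · intro y z hyz
    refine Set.disjoint_left.2 fun x hy hz => hyz ?_
    rw [← (mem_meshCell_iff hδ).1 hy, (mem_meshCell_iff hδ).1 hz]

theorem pcn_eq_of_mem_meshCell {n : ℕ} {δ : ℝ} (hδ : 0 < δ) (w : EuclideanSpace ℝ (Fin n) → ℝ)
    {z : Fin n → ℤ} {x : EuclideanSpace ℝ (Fin n)} (hx : x ∈ meshCell n δ z) :
    pcn n δ w x = ⨍ y in meshCell n δ z, w y := by
  rw [pcn, (mem_meshCell_iff hδ).1 hx, setAverage_congr (meshCube_ae_eq_meshCell n δ z)]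

/-- Each cell of the halved mesh lies in a single cell of the original mesh. -/
theorem meshCell_half_subset {n : ℕ} {δ : ℝ} (hδ : 0 < δ) (z : Fin n → ℤ) :
    meshCell n (δ / 2) z ⊆ meshCell n δ fun i => z i / 2 := by
  intro x hx i
  obtain ⟨h₁, h₂⟩ := hx i
  have hlow : ((2 * (z i / 2) : ℤ) : ℝ) ≤ z i := by exact_mod_cast (by omega)
  have hupp : (z i : ℝ) + 1 ≤ ((2 * (z i / 2) + 2 : ℤ) : ℝ) := by exact_mod_cast (by omega)
  push_cast only [Int.cast_mul, Int.cast_add, Int.cast_ofNat] at hlow hupp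
  constructor <;> nlinarith

/-- `‖w - w^{δ/2}‖_{L^1(ℝ^n)} ≤ (1 + 2^n)·‖w - w^δ‖_{L^1(ℝ^n)}`, as an inequality in `[0,∞]`. -/
theorem stmt13 (n : ℕ) (hn : 1 ≤ n) (w : EuclideanSpace ℝ (Fin n) → ℝ)
    (hw : LocallyIntegrable w volume) (δ : ℝ) (hδ : 0 < δ) :
    ∫⁻ x, ENNReal.ofReal |w x - pcn n (δ / 2) w x| ≤
      (1 + 2 ^ n) * ∫⁻ x, ENNReal.ofReal |w x - pcn n δ w x| := by
  simp only [← Real.enorm_eq_ofReal_abs]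
  have hδ2 : 0 < δ / 2 := half_pos hδ
  have htwo : (2 : ℝ≥0∞) ≤ 1 + 2 ^ n := by
    rw [← one_add_one_eq_two]
    gcongr
    exact one_le_pow₀ (by norm_num)
  refine le_trans ?_ (mul_le_mul_left htwo _)
  rw [lintegral_eq_tsum_meshCell hδ2, lintegral_eq_tsum_meshCell hδ2, ← ENNReal.tsum_mul_left]
  refine ENNReal.tsum_le_tsum fun z => ?_
  have hm := measurableSet_meshCell n (δ / 2) z
  obtain ⟨k, hk, hzk⟩ := exists_isCompact_meshCell_subset n (δ / 2) z
  have : IsFiniteMeasure (volume.restrict (meshCell n (δ / 2) z)) :=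
    isFiniteMeasure_restrict.2 (measure_mono hzk |>.trans_lt hk.measure_lt_top).ne
  calc ∫⁻ x in meshCell n (δ / 2) z, ‖w x - pcn n (δ / 2) w x‖ₑ
      = ∫⁻ x in meshCell n (δ / 2) z, ‖w x - ⨍ y in meshCell n (δ / 2) z, w y‖ₑ :=
        setLIntegral_congr_fun hm fun x hx => by rw [pcn_eq_of_mem_meshCell hδ2 w hx]
    _ ≤ 2 * ∫⁻ x in meshCell n (δ / 2) z, ‖w x - ⨍ y in meshCell n δ fun i => z i / 2, w y‖ₑ :=
        lintegral_enorm_sub_average_le ((hw.integrableOn_isCompact hk).mono_set hzk) _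
    _ = 2 * ∫⁻ x in meshCell n (δ / 2) z, ‖w x - pcn n δ w x‖ₑ := by
        congr 1
        exact setLIntegral_congr_fun hm fun x hx => by
          rw [pcn_eq_of_mem_meshCell hδ w (meshCell_half_subset hδ z hx)]
end
end

section
/- If f ∈ C^∞(ℝ^n), then lim_{ε→0} K_ε(f) = (1/4) ∫_{ℝ^n} |∇f(x)| dx (an equality in [0,∞]). -/
open MeasureTheory Filter Topology ENNReal

noncomputable section

/-- Even continuous functions with nonnegative primitive on `[0, ∞)`: the test functions that have
nonnegative integral against every symmetric unimodal law. -/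
structure OscKernel (k : ℝ → ℝ) : Prop where
  continuous : Continuous k
  even : ∀ x, k (-x) = k x
  primitive_nonneg : ∀ x, 0 ≤ x → 0 ≤ ∫ t in (0 : ℝ)..x, k t

theorem integral_odd_eq_zero {K : ℝ → ℝ} (hodd : ∀ x, K (-x) = -K x) (r : ℝ) :
    ∫ v in -r..r, K v = 0 := by
  have h := intervalIntegral.integral_comp_neg (a := -r) (b := r) K
  simp only [hodd, neg_neg, intervalIntegral.integral_neg] at h
  linarith

theorem integral_shift_odd_nonneg {K : ℝ → ℝ} (hc : Continuous K) (hodd : ∀ x, K (-x) = -K x)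
    (hpos : ∀ x, 0 ≤ x → 0 ≤ K x) {x r : ℝ} (hx : 0 ≤ x) (hr : 0 ≤ r) :
    0 ≤ ∫ v in -r..r, K (x + v) := by
  rw [intervalIntegral.integral_comp_add_left]
  rcases le_total r x with h | h
  · exact intervalIntegral.integral_nonneg (by linarith) fun u hu => hpos u (by linarith [hu.1])
  · rw [← intervalIntegral.integral_add_adjacent_intervals (b := r - x)
      (hc.intervalIntegrable _ _) (hc.intervalIntegrable _ _)]
    have h0 := integral_odd_eq_zero hodd (r - x)
    rw [show x + -r = -(r - x) by ring, h0, zero_add]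
    exact intervalIntegral.integral_nonneg (by linarith) fun u hu => hpos u (by linarith [hu.1])

theorem integral_shift_mul_odd_nonneg {K : ℝ → ℝ} (hc : Continuous K)
    (hodd : ∀ x, K (-x) = -K x) (hpos : ∀ x, 0 ≤ x → 0 ≤ K x) {x h : ℝ} (hx : 0 ≤ x)
    (hh : 0 ≤ h) (a : ℝ) : 0 ≤ ∫ v in -h..h, K (x + a * v) := by
  wlog ha : 0 ≤ a generalizing a with H
  · have := H (-a) (by linarith)
    have h' := intervalIntegral.integral_comp_neg (a := -h) (b := h) fun v => K (x + a * v)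
    simp only [mul_neg, neg_neg] at h'
    simpa [← h'] using this
  rcases ha.eq_or_lt with rfl | ha
  · simp only [zero_mul, add_zero, intervalIntegral.integral_const, smul_eq_mul]
    exact mul_nonneg (by linarith) (hpos x hx)
  · rw [intervalIntegral.integral_comp_mul_left (fun v => K (x + v)) ha.ne', smul_eq_mul,
      mul_neg]
    exact mul_nonneg (by positivity) (integral_shift_odd_nonneg hc hodd hpos hx (by positivity))

theorem OscKernel.smear {k : ℝ → ℝ} (hk : OscKernel k) {h : ℝ} (hh : 0 ≤ h) (a : ℝ) :
    OscKernel fun t => ∫ u in -h..h, k (t + a * u) := by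
  have hkc := hk.continuous
  refine ⟨?_, fun x => ?_, fun x hx => ?_⟩
  · exact intervalIntegral.continuous_parametric_intervalIntegral_of_continuous'
      (f := fun t u => k (t + a * u)) (by unfold Function.uncurry; fun_prop) _ _
  · have := intervalIntegral.integral_comp_neg (a := -h) (b := h) fun u => k (-x + a * u)
    rw [neg_neg] at this
    rw [← this]
    congr 1; ext u
    rw [← hk.even]; congr 1; ring
  · set K : ℝ → ℝ := fun x => ∫ t in (0 : ℝ)..x, k t with hK
    have hKc : Continuous K := intervalIntegral.continuous_primitive
      (fun a b => hkc.intervalIntegrable a b) 0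
    have hodd : ∀ x, K (-x) = -K x := fun x => by
      have := intervalIntegral.integral_comp_neg (a := 0) (b := x) k
      simp only [hk.even, neg_zero] at this
      rw [hK]; simp only
      rw [this, intervalIntegral.integral_symm]
    have hsw : ∫ t in (0 : ℝ)..x, ∫ u in -h..h, k (t + a * u)
        = ∫ u in -h..h, ∫ t in (0 : ℝ)..x, k (t + a * u) := by
      apply intervalIntegral_intervalIntegral_swap
      have hc : Continuous fun p : ℝ × ℝ => k (p.1 + a * p.2) := by fun_prop
      exact (hc.continuousOn.integrableOn_compact
        (isCompact_uIcc.prod isCompact_uIcc)).mono_set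
          (Set.prod_mono Set.uIoc_subset_uIcc Set.uIoc_subset_uIcc)
    rw [hsw]
    have : ∀ u, ∫ t in (0 : ℝ)..x, k (t + a * u) = K (x + a * u) - K (a * u) := fun u => by
      rw [intervalIntegral.integral_comp_add_right, zero_add, hK]
      exact (intervalIntegral.integral_interval_sub_left (hkc.intervalIntegrable _ _)
        (hkc.intervalIntegrable _ _)).symm
    simp only [this]
    rw [intervalIntegral.integral_sub (Continuous.intervalIntegrable (by fun_prop) _ _)
      (Continuous.intervalIntegrable (by fun_prop) _ _),
      integral_odd_eq_zero (K := fun u => K (a * u)) (fun u => by simp [hodd]), sub_zero]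
    exact integral_shift_mul_odd_nonneg hKc hodd hk.primitive_nonneg hx hh a

theorem OscKernel.zero_nonneg {k : ℝ → ℝ} (hk : OscKernel k) : 0 ≤ k 0 := by
  by_contra! hneg
  obtain ⟨δ, hδ, hball⟩ := Metric.mem_nhds_iff.1
    (hk.continuous.continuousAt.eventually_lt continuousAt_const hneg)
  have h1 := hk.primitive_nonneg (δ / 2) (by positivity)
  have h2 : ∫ t in (0 : ℝ)..(δ / 2), k t < ∫ t in (0 : ℝ)..(δ / 2), (0 : ℝ) := by
    apply intervalIntegral.integral_lt_integral_of_continuousOn_of_le_of_exists_lt (by positivity)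
      hk.continuous.continuousOn continuousOn_const
    · intro x hx
      refine (hball ?_).le
      rw [Metric.mem_ball, Real.dist_eq, abs_lt]; constructor <;> linarith [hx.1, hx.2]
    · exact ⟨0, ⟨le_rfl, by positivity⟩, hneg⟩
  simp at h2
  linarith

theorem oscKernel_quadratic (c : ℝ) : OscKernel fun x => c ^ 2 + 3 * x ^ 2 - 4 * c * |x| := by
  refine ⟨by fun_prop, fun x => by simp, fun x hx => ?_⟩
  have : ∫ t in (0 : ℝ)..x, (c ^ 2 + 3 * t ^ 2 - 4 * c * |t|)
      = ∫ t in (0 : ℝ)..x, (c ^ 2 + 3 * t ^ 2 - 4 * c * t) := by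
    apply intervalIntegral.integral_congr
    intro t ht
    rw [Set.uIcc_of_le hx] at ht
    simp only [abs_of_nonneg ht.1]
  rw [this, intervalIntegral.integral_sub (Continuous.intervalIntegrable (by fun_prop) _ _)
    (Continuous.intervalIntegrable (by fun_prop) _ _),
    intervalIntegral.integral_add (Continuous.intervalIntegrable (by fun_prop) _ _)
    (Continuous.intervalIntegrable (by fun_prop) _ _)]
  simp only [intervalIntegral.integral_const, intervalIntegral.integral_const_mul, integral_pow,
    smul_eq_mul]
  have := mul_nonneg hx (sq_nonneg (c - x))
  have h4 : ∫ t in (0 : ℝ)..x, 4 * c * t = 2 * c * x ^ 2 := by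
    rw [intervalIntegral.integral_const_mul, integral_id]; ring
  rw [h4]
  norm_num
  nlinarith

/-- Lebesgue measure on the centred box `(-h, h)^n`. -/
def boxMeasure (n : ℕ) (h : ℝ) : Measure (Fin n → ℝ) :=
  Measure.pi fun _ => volume.restrict (Set.Ioo (-h) h)

theorem boxMeasure_eq (n : ℕ) (h : ℝ) :
    boxMeasure n h = volume.restrict (Set.univ.pi fun _ => Set.Ioo (-h) h) :=
  (Measure.restrict_pi_pi _ _).symm

theorem Continuous.integrable_boxMeasure {n : ℕ} {F : (Fin n → ℝ) → ℝ} (hF : Continuous F)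
    (h : ℝ) : Integrable F (boxMeasure n h) := by
  rw [boxMeasure_eq]
  exact (hF.continuousOn.integrableOn_compact
    (isCompact_univ_pi fun _ => isCompact_Icc)).mono_set
      (Set.pi_mono fun _ _ => Set.Ioo_subset_Icc_self)

theorem integral_boxMeasure_succ {n : ℕ} {h : ℝ} (hh : 0 ≤ h) (a : Fin (n + 1) → ℝ)
    {k : ℝ → ℝ} (hk : Continuous k) :
    ∫ x, k (∑ i, a i * x i) ∂boxMeasure (n + 1) h
      = ∫ y, (∫ u in -h..h, k ((∑ i, a i.succ * y i) + a 0 * u)) ∂boxMeasure n h := by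
  have hint : Integrable (fun x : Fin (n + 1) → ℝ => k (∑ i, a i * x i))
      (boxMeasure (n + 1) h) := Continuous.integrable_boxMeasure (by fun_prop) h
  unfold boxMeasure at *
  have hmp := (measurePreserving_piFinSuccAbove
    (fun _ : Fin (n + 1) => (volume : Measure ℝ).restrict (Set.Ioo (-h) h)) 0).symm
  rw [← hmp.integrable_comp_emb (MeasurableEquiv.measurableEmbedding _)] at hint
  rw [← hmp.integral_comp']
  simp only [Function.comp_def, MeasurableEquiv.piFinSuccAbove_symm_apply, Fin.insertNthEquiv,
    Fin.sum_univ_succ, Fin.insertNth_zero, Equiv.coe_fn_mk, Fin.cons_zero, Fin.cons_succ]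
    at hint ⊢
  rw [integral_prod_symm _ hint]
  congr 1; ext y
  rw [intervalIntegral.integral_of_le (by linarith), integral_Ioc_eq_integral_Ioo]
  simp only [add_comm, cast_eq]

theorem OscKernel.integral_boxMeasure_nonneg {n : ℕ} {h : ℝ} (hh : 0 ≤ h) (a : Fin n → ℝ)
    {k : ℝ → ℝ} (hk : OscKernel k) : 0 ≤ ∫ x, k (∑ i, a i * x i) ∂boxMeasure n h := by
  induction n generalizing k with
  | zero => simpa [boxMeasure, measureReal_def] using hk.zero_nonneg
  | succ n ih =>
    rw [integral_boxMeasure_succ hh a hk.continuous]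
    exact ih (fun i => a i.succ) (hk.smear hh (a 0))

theorem integral_boxMeasure_quadratic {n : ℕ} {h : ℝ} (hh : 0 ≤ h) (a : Fin n → ℝ) (A B : ℝ) :
    ∫ x, (A + B * (∑ i, a i * x i) ^ 2) ∂boxMeasure n h
      = (2 * h) ^ n * (A + B * (h ^ 2 / 3 * ∑ i, a i ^ 2)) := by
  induction n generalizing A B with
  | zero => simp [boxMeasure, measureReal_def]
  | succ n ih =>
    rw [integral_boxMeasure_succ hh a (k := fun s => A + B * s ^ 2) (by fun_prop)]
    have key : ∀ t : ℝ, ∫ u in -h..h, (A + B * (t + a 0 * u) ^ 2)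
        = (2 * h * A + B * (a 0 ^ 2 * (2 * h ^ 3 / 3))) + 2 * h * B * t ^ 2 := fun t => by
      have : ∀ u, A + B * (t + a 0 * u) ^ 2
        = (A + B * t ^ 2) + (2 * B * t * a 0) * u + (B * a 0 ^ 2) * u ^ 2 := fun u => by ring
      simp only [this]
      rw [intervalIntegral.integral_add (Continuous.intervalIntegrable (by fun_prop) _ _)
        (Continuous.intervalIntegrable (by fun_prop) _ _),
        intervalIntegral.integral_add (Continuous.intervalIntegrable (by fun_prop) _ _)
        (Continuous.intervalIntegrable (by fun_prop) _ _), intervalIntegral.integral_const_mul,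
        intervalIntegral.integral_const_mul, integral_id, integral_pow,
        intervalIntegral.integral_const, smul_eq_mul]
      norm_num
      ring
    simp only [key]
    rw [ih, Fin.sum_univ_succ]
    ring

/-- The sharp first-moment Khinchine inequality for sums of independent uniform variables. -/
theorem integral_boxMeasure_abs_le {n : ℕ} {h : ℝ} (hh : 0 < h) (a : Fin n → ℝ) :
    ∫ x, |∑ i, a i * x i| ∂boxMeasure n h
      ≤ (2 * h) ^ n * (h / 2 * Real.sqrt (∑ i, a i ^ 2)) := by
  have hs : 0 ≤ ∑ i, a i ^ 2 := Finset.sum_nonneg fun i _ => sq_nonneg _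
  rcases hs.eq_or_lt with h0 | hpos
  · have : ∀ i, a i = 0 := fun i => by
      have := (Finset.sum_eq_zero_iff_of_nonneg fun i _ => sq_nonneg (a i)).1 h0.symm i
        (Finset.mem_univ i)
      simpa using this
    simp [this]
  set r := Real.sqrt (∑ i, a i ^ 2) with hr
  have hrpos : 0 < r := Real.sqrt_pos.2 hpos
  have hr2 : ∑ i, a i ^ 2 = r ^ 2 := (Real.sq_sqrt hs).symm
  have h1 := (oscKernel_quadratic (h * r)).integral_boxMeasure_nonneg hh.le a
  rw [integral_sub (Continuous.integrable_boxMeasure (by fun_prop) h)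
    (Continuous.integrable_boxMeasure (by fun_prop) h), integral_boxMeasure_quadratic hh.le,
    integral_const_mul, hr2] at h1
  have h2 : 0 < h * r := by positivity
  have h3 : (h * r) * ∫ x, |∑ i, a i * x i| ∂boxMeasure n h
      ≤ (h * r) * ((2 * h) ^ n * (h / 2 * r)) := by
    nlinarith
  exact le_of_mul_le_mul_left h3 h2

theorem integral_boxMeasure_abs_single {n : ℕ} {h : ℝ} (hh : 0 < h) (r : ℝ) (i₀ : Fin n) :
    ∫ x, |r * x i₀| ∂boxMeasure n h = (2 * h) ^ n * (h / 2 * |r|) := by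
  have h1 : ∫ x in Set.Ioo (-h) h, |x| = h ^ 2 := by
    rw [← integral_Ioc_eq_integral_Ioo, ← intervalIntegral.integral_of_le (by linarith),
      ← intervalIntegral.integral_add_adjacent_intervals (b := 0)
      (Continuous.intervalIntegrable (by fun_prop) _ _)
      (Continuous.intervalIntegrable (by fun_prop) _ _)]
    have e1 : ∫ x in -h..0, |x| = ∫ x in -h..0, -x :=
      intervalIntegral.integral_congr fun x hx => by
        rw [Set.uIcc_of_le (by linarith)] at hx; exact abs_of_nonpos hx.2
    have e2 : ∫ x in 0..h, |x| = ∫ x in 0..h, x :=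
      intervalIntegral.integral_congr fun x hx => by
        rw [Set.uIcc_of_le hh.le] at hx; exact abs_of_nonneg hx.1
    rw [e1, e2, intervalIntegral.integral_neg, integral_id, integral_id]
    ring
  have h2 := integral_fin_nat_prod_eq_prod (𝕜 := ℝ) (n := n)
    (μ := fun _ => (volume : Measure ℝ).restrict (Set.Ioo (-h) h))
    (fun i x => if i = i₀ then |x| else 1)
  have h3 : ∀ x : Fin n → ℝ, ∏ i, (if i = i₀ then |x i| else 1) = |x i₀| := fun x => by
    rw [Finset.prod_ite_eq' Finset.univ i₀ fun i => |x i|]; simp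
  have h4 : ∀ i, ∫ x in Set.Ioo (-h) h, (if i = i₀ then |x| else (1 : ℝ))
      = (2 * h) * (if i = i₀ then h / 2 else 1) := fun i => by
    split_ifs
    · rw [h1]; ring
    · simp [measureReal_def]
      rw [ENNReal.toReal_ofReal (by linarith)]; ring
  simp only [h3, h4, Finset.prod_mul_distrib, Finset.prod_const, Finset.card_univ,
    Fintype.card_fin] at h2
  rw [Finset.prod_ite_eq' Finset.univ i₀ fun _ => h / 2] at h2
  simp only [abs_mul, integral_const_mul]
  unfold boxMeasure
  rw [h2]; simp; ring

/-- The open cube `(-h, h)^n`. -/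
def centredCube (n : ℕ) (h : ℝ) : Set (EuclideanSpace ℝ (Fin n)) :=
  {x | ∀ i, x i ∈ Set.Ioo (-h) h}

theorem centredCube_eq_preimage (n : ℕ) (h : ℝ) :
    centredCube n h = WithLp.ofLp ⁻¹' (Set.univ.pi fun _ => Set.Ioo (-h) h) := by
  ext x; simp [centredCube, Set.mem_pi]

theorem isOpen_centredCube (n : ℕ) (h : ℝ) : IsOpen (centredCube n h) := by
  rw [centredCube_eq_preimage]
  exact (isOpen_set_pi Set.finite_univ fun _ _ => isOpen_Ioo).preimage
    (PiLp.continuous_ofLp 2 _)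

theorem convex_centredCube (n : ℕ) (h : ℝ) : Convex ℝ (centredCube n h) := by
  intro x hx y hy a b ha hb hab i
  exact convex_Ioo (-h) h (hx i) (hy i) ha hb hab

theorem neg_mem_centredCube {n : ℕ} {h : ℝ} {x : EuclideanSpace ℝ (Fin n)} :
    -x ∈ centredCube n h ↔ x ∈ centredCube n h := by
  refine forall_congr' fun i => ?_
  simp only [PiLp.neg_apply, Set.mem_Ioo]
  constructor <;> rintro ⟨h1, h2⟩ <;> constructor <;> linarith

theorem dist_le_of_mem_centredCube {n : ℕ} {h : ℝ} {x y : EuclideanSpace ℝ (Fin n)}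
    (hx : x ∈ centredCube n h) (hy : y ∈ centredCube n h) : dist x y ≤ √n * (2 * h) := by
  have hd : ∀ i, dist (x i) (y i) ≤ 2 * h := fun i => by
    have h1 := hx i; have h2 := hy i
    rw [Real.dist_eq, abs_le]
    constructor <;> linarith [h1.1, h1.2, h2.1, h2.2]
  rw [EuclideanSpace.dist_eq]
  rcases isEmpty_or_nonempty (Fin n) with he | ⟨⟨i⟩⟩
  · have : n = 0 := by by_contra h0; exact he.elim ⟨0, Nat.pos_of_ne_zero h0⟩
    subst this; simp
  have hh : 0 ≤ 2 * h := dist_nonneg.trans (hd i)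
  apply Real.sqrt_le_iff.2 ⟨by positivity, ?_⟩
  calc ∑ i, dist (x i) (y i) ^ 2 ≤ ∑ _i : Fin n, (2 * h) ^ 2 :=
        Finset.sum_le_sum fun i _ => pow_le_pow_left₀ dist_nonneg (hd i) 2
    _ = (√n * (2 * h)) ^ 2 := by simp [mul_pow, Real.sq_sqrt]

theorem setIntegral_centredCube (n : ℕ) (h : ℝ) (g : EuclideanSpace ℝ (Fin n) → ℝ) :
    ∫ x in centredCube n h, g x = ∫ x, g (WithLp.toLp 2 x) ∂boxMeasure n h := by
  rw [boxMeasure_eq, centredCube_eq_preimage]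
  exact (PiLp.volume_preserving_ofLp (Fin n)).setIntegral_preimage_emb
    (MeasurableEquiv.toLp 2 (Fin n → ℝ)).symm.measurableEmbedding (fun x => g (WithLp.toLp 2 x)) _

theorem volume_centredCube (n : ℕ) (h : ℝ) :
    volume (centredCube n h) = ENNReal.ofReal (2 * h) ^ n := by
  rw [centredCube_eq_preimage, (PiLp.volume_preserving_ofLp (Fin n)).measure_preimage_emb
    (MeasurableEquiv.toLp 2 (Fin n → ℝ)).symm.measurableEmbedding]
  simp [Real.volume_pi_Ioo, two_mul]

theorem AffineIsometryEquiv.apply_eq_linear_add {n : ℕ}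
    (T : EuclideanSpace ℝ (Fin n) ≃ᵃⁱ[ℝ] EuclideanSpace ℝ (Fin n))
    (x : EuclideanSpace ℝ (Fin n)) : T x = T.linearIsometryEquiv x + T 0 := by
  have := T.map_vadd 0 x
  simpa using this

theorem AffineIsometryEquiv.measurePreserving {n : ℕ}
    (T : EuclideanSpace ℝ (Fin n) ≃ᵃⁱ[ℝ] EuclideanSpace ℝ (Fin n)) :
    MeasurePreserving T := by
  have : (T : EuclideanSpace ℝ (Fin n) → EuclideanSpace ℝ (Fin n))
      = (fun x => x + T 0) ∘ T.linearIsometryEquiv := funext T.apply_eq_linear_add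
  rw [this]
  exact (measurePreserving_add_right volume (T 0)).comp T.linearIsometryEquiv.measurePreserving

theorem isCube_image {n : ℕ} (ε : ℝ)
    (T : EuclideanSpace ℝ (Fin n) ≃ᵃⁱ[ℝ] EuclideanSpace ℝ (Fin n)) :
    IsCube n ε (T '' centredCube n (ε / 2)) := by
  refine ⟨(IsometryEquiv.subRight (WithLp.toLp 2 fun _ => ε / 2)).trans T.toIsometryEquiv, ?_⟩
  change _ = (T ∘ IsometryEquiv.subRight (WithLp.toLp 2 fun _ => ε / 2)) '' _
  rw [Set.image_comp]
  congr 1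
  ext x
  simp only [Set.mem_image, centredCube, stdCube, Set.mem_ofPred_eq]
  constructor
  · intro hx
    refine ⟨x + WithLp.toLp 2 fun _ => ε / 2, fun i => ?_, by simp⟩
    have := hx i
    simp only [PiLp.add_apply, Set.mem_Ioo] at this ⊢
    constructor <;> linarith
  · rintro ⟨y, hy, rfl⟩ i
    have := hy i
    simp only [IsometryEquiv.subRight_apply, PiLp.sub_apply, Set.mem_Ioo] at this ⊢
    constructor <;> linarith

theorem IsCube.exists_affine {n : ℕ} {ε : ℝ} {Q : Set (EuclideanSpace ℝ (Fin n))}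
    (hQ : IsCube n ε Q) : ∃ T : EuclideanSpace ℝ (Fin n) ≃ᵃⁱ[ℝ] EuclideanSpace ℝ (Fin n),
      Q = T '' centredCube n (ε / 2) := by
  obtain ⟨T, rfl⟩ := hQ
  refine ⟨((IsometryEquiv.addRight (WithLp.toLp 2 fun _ => ε / 2)).trans
    T).toRealAffineIsometryEquiv, ?_⟩
  rw [IsometryEquiv.coeFn_toRealAffineIsometryEquiv]
  change _ = (T ∘ IsometryEquiv.addRight (WithLp.toLp 2 fun _ => ε / 2)) '' _
  rw [Set.image_comp]
  congr 1
  ext x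
  simp only [Set.mem_image, centredCube, stdCube, Set.mem_ofPred_eq]
  constructor
  · intro hx
    refine ⟨x - WithLp.toLp 2 fun _ => ε / 2, fun i => ?_, by simp⟩
    have := hx i
    simp only [PiLp.sub_apply, Set.mem_Ioo] at this ⊢
    constructor <;> linarith
  · rintro ⟨y, hy, rfl⟩ i
    have := hy i
    simp only [IsometryEquiv.addRight_apply, PiLp.add_apply, Set.mem_Ioo] at this ⊢
    constructor <;> linarith

section Cube

variable {n : ℕ} {ε : ℝ} {Q : Set (EuclideanSpace ℝ (Fin n))}

theorem IsCube.isOpen (hQ : IsCube n ε Q) : IsOpen Q := by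
  obtain ⟨T, rfl⟩ := hQ.exists_affine
  exact T.toHomeomorph.isOpenMap _ (isOpen_centredCube n _)

theorem IsCube.convex (hQ : IsCube n ε Q) : Convex ℝ Q := by
  obtain ⟨T, rfl⟩ := hQ.exists_affine
  exact (convex_centredCube n _).affine_image T.toAffineEquiv.toAffineMap

theorem IsCube.dist_le (hQ : IsCube n ε Q) {x y : EuclideanSpace ℝ (Fin n)} (hx : x ∈ Q)
    (hy : y ∈ Q) : dist x y ≤ √n * ε := by
  obtain ⟨T, rfl⟩ := hQ.exists_affine
  obtain ⟨x, hx, rfl⟩ := hx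
  obtain ⟨y, hy, rfl⟩ := hy
  rw [T.dist_map]
  have := dist_le_of_mem_centredCube hx hy
  rwa [mul_div_cancel₀ _ (two_ne_zero)] at this

theorem IsCube.volume_eq (hQ : IsCube n ε Q) : volume Q = ENNReal.ofReal ε ^ n := by
  obtain ⟨T, rfl⟩ := hQ.exists_affine
  have h := T.measurePreserving.measure_preimage_emb
    T.toHomeomorph.measurableEmbedding (T '' centredCube n (ε / 2))
  rw [Set.preimage_image_eq _ T.injective, volume_centredCube] at h
  rw [← h]; congr 2; ring

theorem IsCube.volume_real (hQ : IsCube n ε Q) (hε : 0 < ε) : volume.real Q = ε ^ n := by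
  rw [measureReal_def, hQ.volume_eq, ENNReal.toReal_pow, ENNReal.toReal_ofReal hε.le]

theorem IsCube.isBounded (hQ : IsCube n ε Q) : Bornology.IsBounded Q :=
  Metric.isBounded_iff.2 ⟨√n * ε, fun _ hx _ hy => hQ.dist_le hx hy⟩

theorem IsCube.integrableOn (hQ : IsCube n ε Q) {g : EuclideanSpace ℝ (Fin n) → ℝ}
    (hg : Continuous g) : IntegrableOn g Q :=
  (hg.continuousOn.integrableOn_compact hQ.isBounded.isCompact_closure).mono_set subset_closure

theorem setIntegral_image_centredCube
    (T : EuclideanSpace ℝ (Fin n) ≃ᵃⁱ[ℝ] EuclideanSpace ℝ (Fin n)) (h : ℝ)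
    (g : EuclideanSpace ℝ (Fin n) → ℝ) :
    ∫ x in T '' centredCube n h, g x = ∫ x in centredCube n h, g (T x) :=
  T.measurePreserving.setIntegral_image_emb T.toHomeomorph.measurableEmbedding _ _

/-- The mean oscillation `⨍_Q |f - ⨍_Q f|`. -/
def meanOsc (Q : Set (EuclideanSpace ℝ (Fin n))) (f : EuclideanSpace ℝ (Fin n) → ℝ) : ℝ :=
  ⨍ x in Q, |f x - ⨍ y in Q, f y|

theorem meanOsc_linear (hε : 0 < ε)
    (T : EuclideanSpace ℝ (Fin n) ≃ᵃⁱ[ℝ] EuclideanSpace ℝ (Fin n))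
    (L : EuclideanSpace ℝ (Fin n) →L[ℝ] ℝ) :
    meanOsc (T '' centredCube n (ε / 2)) L = (ε ^ n)⁻¹ * ∫ x,
      |∑ i, L (T.linearIsometryEquiv (EuclideanSpace.single i 1)) * x i|
        ∂boxMeasure n (ε / 2) := by
  have hQ := isCube_image ε T
  have hodd : ∫ x in centredCube n (ε / 2), L (T.linearIsometryEquiv x) = 0 := by
    have h := (Measure.measurePreserving_neg
      (volume : Measure (EuclideanSpace ℝ (Fin n)))).setIntegral_preimage_emb
      (MeasurableEquiv.neg _).measurableEmbedding
      (fun x => L (T.linearIsometryEquiv x)) (centredCube n (ε / 2))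
    have hpre : (Neg.neg ⁻¹' centredCube n (ε / 2) : Set (EuclideanSpace ℝ (Fin n)))
        = centredCube n (ε / 2) := Set.ext fun x => neg_mem_centredCube
    simp only [hpre, map_neg, integral_neg] at h
    linarith
  have havg : ⨍ y in T '' centredCube n (ε / 2), L y = L (T 0) := by
    rw [setAverage_eq, setIntegral_image_centredCube, hQ.volume_real hε]
    rw [show (fun x => L (T x)) = fun x => L (T.linearIsometryEquiv x) + L (T 0) from
      funext fun x => by rw [T.apply_eq_linear_add x, map_add]]
    have hvol : volume.real (centredCube n (ε / 2)) = ε ^ n := by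
      rw [measureReal_def, volume_centredCube, ENNReal.toReal_pow,
        ENNReal.toReal_ofReal (by linarith)]
      congr 1; ring
    have hQ' : IsCube n ε (centredCube n (ε / 2)) := by
      simpa using isCube_image (n := n) ε (AffineIsometryEquiv.refl ℝ _)
    rw [integral_add (hQ'.integrableOn (by fun_prop)) (hQ'.integrableOn (by fun_prop)), hodd]
    simp only [zero_add, setIntegral_const, hvol, smul_eq_mul]
    field_simp
  rw [meanOsc, havg, setAverage_eq, setIntegral_image_centredCube, hQ.volume_real hε,
    setIntegral_centredCube, smul_eq_mul]
  congr 2; ext x; congr 1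
  rw [T.apply_eq_linear_add (WithLp.toLp 2 x), map_add, add_sub_cancel_right]
  have hx : WithLp.toLp 2 x = ∑ i, x i • EuclideanSpace.single i (1 : ℝ) := by
    ext j; simp [Finset.sum_apply, Pi.single_apply]
  rw [hx]
  simp only [map_sum, map_smul, smul_eq_mul, mul_comm]

theorem norm_sq_eq_sum_apply_single (L : EuclideanSpace ℝ (Fin n) →L[ℝ] ℝ) :
    ‖L‖ ^ 2 = ∑ i, L (EuclideanSpace.single i 1) ^ 2 := by
  obtain ⟨v, rfl⟩ := (InnerProductSpace.toDual ℝ (EuclideanSpace ℝ (Fin n))).surjective L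
  rw [LinearIsometryEquiv.norm_map, EuclideanSpace.norm_sq_eq]
  simp [EuclideanSpace.inner_single_right]

theorem IsCube.meanOsc_linear_le (hQ : IsCube n ε Q) (hε : 0 < ε)
    (L : EuclideanSpace ℝ (Fin n) →L[ℝ] ℝ) : meanOsc Q L ≤ ε / 4 * ‖L‖ := by
  obtain ⟨T, rfl⟩ := hQ.exists_affine
  rw [meanOsc_linear hε]
  have h := integral_boxMeasure_abs_le (half_pos hε)
    fun i => L (T.linearIsometryEquiv (EuclideanSpace.single i 1))
  have hn := norm_sq_eq_sum_apply_single
    (L.comp (T.linearIsometryEquiv : EuclideanSpace ℝ (Fin n) →L[ℝ] EuclideanSpace ℝ (Fin n)))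
  have hn' : ‖L.comp (T.linearIsometryEquiv :
      EuclideanSpace ℝ (Fin n) →L[ℝ] EuclideanSpace ℝ (Fin n))‖ = ‖L‖ :=
    L.opNorm_comp_linearIsometryEquiv T.linearIsometryEquiv
  rw [hn'] at hn
  simp only [ContinuousLinearMap.comp_apply] at hn
  have hs : √(∑ i, L (T.linearIsometryEquiv (EuclideanSpace.single i 1)) ^ 2) = ‖L‖ := by
    rw [Real.sqrt_eq_iff_eq_sq (Finset.sum_nonneg fun _ _ => sq_nonneg _) (norm_nonneg _)]
    exact hn.symm
  rw [hs, mul_div_cancel₀ _ (two_ne_zero)] at h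
  rw [inv_mul_le_iff₀ (by positivity)]
  linarith

/-- Every linear functional is a multiple of a coordinate in a suitable orthonormal frame. -/
theorem exists_linearIsometryEquiv_aligned (i₀ : Fin n)
    (L : EuclideanSpace ℝ (Fin n) →L[ℝ] ℝ) :
    ∃ S : EuclideanSpace ℝ (Fin n) ≃ₗᵢ[ℝ] EuclideanSpace ℝ (Fin n),
      ∀ x, L (S x) = ‖L‖ * x i₀ := by
  obtain ⟨v, rfl⟩ := (InnerProductSpace.toDual ℝ (EuclideanSpace ℝ (Fin n))).surjective L
  rw [LinearIsometryEquiv.norm_map]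
  rcases eq_or_ne v 0 with rfl | hv
  · exact ⟨LinearIsometryEquiv.refl ℝ _, by simp⟩
  have hv' : ‖v‖ ≠ 0 := norm_ne_zero_iff.2 hv
  have hon : Orthonormal ℝ (({i₀} : Set (Fin n)).domRestrict
      fun _ => (‖v‖⁻¹ • v : EuclideanSpace ℝ (Fin n))) := by
    constructor
    · intro i
      simp [norm_smul, hv']
    · intro i j hij
      exact absurd (Subsingleton.elim i j) hij
  obtain ⟨b, hb⟩ := hon.exists_orthonormalBasis_extension_of_card_eq (by simp)
  have hb0 := hb i₀ rfl
  refine ⟨b.repr.symm, fun x => ?_⟩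
  have hvb : v = ‖v‖ • b i₀ := by rw [hb0, smul_smul, mul_inv_cancel₀ hv', one_smul]
  rw [InnerProductSpace.toDual_apply_apply]
  conv_lhs => rw [hvb]
  rw [real_inner_smul_left, ← b.repr_apply_apply, LinearIsometryEquiv.apply_symm_apply]

theorem meanOsc_linear_aligned (hε : 0 < ε) {i₀ : Fin n}
    (T : EuclideanSpace ℝ (Fin n) ≃ᵃⁱ[ℝ] EuclideanSpace ℝ (Fin n))
    {L : EuclideanSpace ℝ (Fin n) →L[ℝ] ℝ}
    (hT : ∀ x, L (T.linearIsometryEquiv x) = ‖L‖ * x i₀) :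
    meanOsc (T '' centredCube n (ε / 2)) L = ε / 4 * ‖L‖ := by
  rw [meanOsc_linear hε]
  have : ∀ x : Fin n → ℝ,
      ∑ i, L (T.linearIsometryEquiv (EuclideanSpace.single i 1)) * x i = ‖L‖ * x i₀ := fun x => by
    simp [hT]
  simp only [this]
  rw [integral_boxMeasure_abs_single (half_pos hε), abs_norm]
  field_simp
  norm_num [mul_comm]

theorem IsCube.meanOsc_sub_le (hQ : IsCube n ε Q) (hε : 0 < ε)
    {f g : EuclideanSpace ℝ (Fin n) → ℝ} (hf : Continuous f) (hg : Continuous g) {c : ℝ}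
    (hc : ∀ x ∈ Q, ∀ y ∈ Q, |(f x - g x) - (f y - g y)| ≤ c) :
    meanOsc Q f ≤ meanOsc Q g + c := by
  have hvol : volume.real Q = ε ^ n := hQ.volume_real hε
  have hvpos : 0 < volume.real Q := by rw [hvol]; positivity
  have hnt : volume Q ≠ ⊤ := by
    rw [hQ.volume_eq]; exact ENNReal.pow_ne_top ENNReal.ofReal_ne_top
  have hpt : ∀ x ∈ Q, |f x - ⨍ y in Q, f y| ≤ |g x - ⨍ y in Q, g y| + c := by
    intro x hx
    have havg : |(f x - ⨍ y in Q, f y) - (g x - ⨍ y in Q, g y)| ≤ c := by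
      have e : (f x - ⨍ y in Q, f y) - (g x - ⨍ y in Q, g y)
          = (volume.real Q)⁻¹ * ∫ y in Q, ((f x - g x) - (f y - g y)) := by
        rw [integral_sub (hQ.integrableOn continuous_const) (hQ.integrableOn (by fun_prop)),
          integral_sub (hQ.integrableOn hf) (hQ.integrableOn hg), setIntegral_const,
          setAverage_eq, setAverage_eq]
        simp only [smul_eq_mul]
        field_simp
        ring
      rw [e, abs_mul, abs_of_pos (inv_pos.2 hvpos), inv_mul_le_iff₀ hvpos]
      have := norm_setIntegral_le_of_norm_le_const (f := fun y => (f x - g x) - (f y - g y))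
        (C := c) hnt.lt_top fun y hy => hc x hx y hy
      rwa [Real.norm_eq_abs, mul_comm] at this
    have := abs_sub_abs_le_abs_sub (f x - ⨍ y in Q, f y) (g x - ⨍ y in Q, g y)
    linarith
  have hmono : ∫ x in Q, |f x - ⨍ y in Q, f y| ≤ ∫ x in Q, (|g x - ⨍ y in Q, g y| + c) :=
    setIntegral_mono_on (hQ.integrableOn (by fun_prop)) (hQ.integrableOn (by fun_prop))
      hQ.isOpen.measurableSet hpt
  rw [integral_add (hQ.integrableOn (by fun_prop)) (hQ.integrableOn (by fun_prop)),
    setIntegral_const, smul_eq_mul] at hmono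
  unfold meanOsc
  generalize ⨍ y in Q, f y = cf at *
  generalize ⨍ y in Q, g y = cg at *
  rw [setAverage_eq, setAverage_eq, smul_eq_mul, smul_eq_mul,
    inv_mul_le_iff₀ hvpos, mul_add, ← mul_assoc, mul_inv_cancel₀ hvpos.ne', one_mul]
  exact hmono

end Cube

theorem lintegral_comp_add_smul_le {n : ℕ} {F : EuclideanSpace ℝ (Fin n) → ℝ≥0∞}
    (hF : Measurable F) (c : EuclideanSpace ℝ (Fin n)) {t : ℝ} (ht : 1 / 2 ≤ t) :
    ∫⁻ x, F (c + t • x) ≤ 2 ^ n * ∫⁻ x, F x := by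
  have ht0 : t ≠ 0 := by linarith
  have h1 : ∫⁻ x, F (c + t • x) = ∫⁻ z, F (c + z) ∂(Measure.map (t • ·) volume) :=
    (lintegral_map (hF.comp (measurable_const_add c)) (measurable_const_smul t)).symm
  rw [h1, Measure.map_addHaar_smul _ ht0, lintegral_smul_measure, lintegral_add_left_eq_self,
    smul_eq_mul, finrank_euclideanSpace_fin]
  gcongr
  rw [abs_inv, abs_of_nonneg (by positivity), ← inv_pow,
    show (2 : ℝ≥0∞) ^ n = ENNReal.ofReal (2 ^ n) by simp [ENNReal.ofReal_pow]]
  apply ENNReal.ofReal_le_ofReal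
  apply pow_le_pow_left₀ (by positivity)
  rw [inv_le_comm₀ (by linarith) two_pos]; linarith

theorem Convex.setLIntegral_comp_segment_le {n : ℕ} {Q : Set (EuclideanSpace ℝ (Fin n))}
    (hQ : Convex ℝ Q) (hQm : MeasurableSet Q) {g : EuclideanSpace ℝ (Fin n) → ℝ≥0∞}
    (hg : Measurable g) {y : EuclideanSpace ℝ (Fin n)} (hy : y ∈ Q) {t : ℝ} (ht : 1 / 2 ≤ t)
    (ht1 : t ≤ 1) :
    ∫⁻ x in Q, g ((1 - t) • y + t • x) ≤ 2 ^ n * ∫⁻ x in Q, g x := by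
  rw [← lintegral_indicator hQm, ← lintegral_indicator hQm]
  refine le_trans (lintegral_mono fun x => ?_)
    (lintegral_comp_add_smul_le (hg.indicator hQm) ((1 - t) • y) ht)
  by_cases hx : x ∈ Q
  · have : (1 - t) • y + t • x ∈ Q := hQ hy hx (by linarith) (by linarith) (by ring)
    simp [hx, this]
  · simp [hx]

theorem Convex.setLIntegral_setLIntegral_segment_le {n : ℕ}
    {Q : Set (EuclideanSpace ℝ (Fin n))} (hQ : Convex ℝ Q) (hQm : MeasurableSet Q)
    {g : EuclideanSpace ℝ (Fin n) → ℝ≥0∞} (hg : Measurable g) {t : ℝ}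
    (ht : t ∈ Set.Icc (0 : ℝ) 1) :
    ∫⁻ x in Q, ∫⁻ y in Q, g ((1 - t) • y + t • x) ≤ 2 ^ n * (∫⁻ x in Q, g x) * volume Q := by
  rcases le_total (1 / 2) t with h | h
  · rw [lintegral_lintegral_swap (by apply Measurable.aemeasurable; fun_prop)]
    refine le_trans (setLIntegral_mono' hQm fun y hy =>
      hQ.setLIntegral_comp_segment_le hQm hg hy h ht.2) ?_
    rw [setLIntegral_const]
  · refine le_trans (setLIntegral_mono' hQm fun x hx => ?_) (setLIntegral_const _ _).le
    have := hQ.setLIntegral_comp_segment_le hQm hg hx (t := 1 - t) (by linarith)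
      (by linarith [ht.1])
    simpa [add_comm] using this

theorem Convex.lintegral_segment_le {n : ℕ} {Q : Set (EuclideanSpace ℝ (Fin n))}
    (hQ : Convex ℝ Q) (hQm : MeasurableSet Q) {g : EuclideanSpace ℝ (Fin n) → ℝ≥0∞}
    (hg : Measurable g) :
    ∫⁻ x in Q, ∫⁻ y in Q, ∫⁻ t in Set.Icc (0 : ℝ) 1, g ((1 - t) • y + t • x)
      ≤ 2 ^ n * (∫⁻ x in Q, g x) * volume Q := by
  have hmeas : Measurable fun p : (EuclideanSpace ℝ (Fin n) × ℝ) × EuclideanSpace ℝ (Fin n) =>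
      g ((1 - p.1.2) • p.2 + p.1.2 • p.1.1) := by fun_prop
  have hswap : ∀ x, ∫⁻ y in Q, ∫⁻ t in Set.Icc (0 : ℝ) 1, g ((1 - t) • y + t • x)
      = ∫⁻ t in Set.Icc (0 : ℝ) 1, ∫⁻ y in Q, g ((1 - t) • y + t • x) := fun x =>
    lintegral_lintegral_swap (Measurable.aemeasurable (by fun_prop))
  simp_rw [hswap]
  rw [lintegral_lintegral_swap hmeas.lintegral_prod_right'.aemeasurable]
  refine le_trans (setLIntegral_mono' measurableSet_Icc fun t ht =>
    hQ.setLIntegral_setLIntegral_segment_le hQm hg ht) ?_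
  simp

theorem enorm_sub_le_lintegral_segment {n : ℕ} {f : EuclideanSpace ℝ (Fin n) → ℝ}
    (hf : ContDiff ℝ 1 f) (x y : EuclideanSpace ℝ (Fin n)) :
    ‖f x - f y‖ₑ ≤ ‖x - y‖ₑ * ∫⁻ t in Set.Icc (0 : ℝ) 1,
      ‖fderiv ℝ f ((1 - t) • y + t • x)‖ₑ := by
  have hcont : Continuous (fderiv ℝ f) := hf.continuous_fderiv (by norm_num)
  have hder : ∀ t : ℝ, HasDerivAt (fun t : ℝ => f ((1 - t) • y + t • x))
      (fderiv ℝ f ((1 - t) • y + t • x) (x - y)) t := fun t => by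
    have h1 : HasDerivAt (fun t : ℝ => (1 - t) • y + t • x) (x - y) t := by
      have := (((hasDerivAt_id t).const_sub 1).smul_const y).add
        ((hasDerivAt_id t).smul_const x)
      rw [show x - y = (-1 : ℝ) • y + (1 : ℝ) • x by module]
      exact this
    exact (hf.differentiable (by norm_num) _).hasFDerivAt.comp_hasDerivAt t h1
  have hint := intervalIntegral.integral_eq_sub_of_hasDerivAt (a := 0) (b := 1)
    (fun t _ => hder t) (Continuous.intervalIntegrable (by fun_prop) _ _)
  simp only [sub_self, zero_smul, one_smul, zero_add, sub_zero, add_zero] at hint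
  rw [← hint, intervalIntegral.integral_of_le zero_le_one, ← integral_Icc_eq_integral_Ioc]
  refine (enorm_integral_le_lintegral_enorm _).trans ?_
  rw [← lintegral_const_mul _ (by fun_prop)]
  refine lintegral_mono fun t => ?_
  rw [mul_comm]
  exact ContinuousLinearMap.le_opENorm _ _

/-- The `L¹` Poincaré inequality on cubes. -/
theorem IsCube.poincare {n : ℕ} {ε : ℝ} {Q : Set (EuclideanSpace ℝ (Fin n))}
    (hQ : IsCube n ε Q) (hε : 0 < ε) {f : EuclideanSpace ℝ (Fin n) → ℝ} (hf : ContDiff ℝ 1 f) :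
    ENNReal.ofReal (meanOsc Q f) * volume Q
      ≤ ENNReal.ofReal (√n * ε) * 2 ^ n * ∫⁻ x in Q, ‖fderiv ℝ f x‖ₑ := by
  have hfc := hf.continuous
  have hcont : Continuous (fderiv ℝ f) := hf.continuous_fderiv (by norm_num)
  have hQm := hQ.isOpen.measurableSet
  have hvol : volume.real Q = ε ^ n := hQ.volume_real hε
  have hvpos : 0 < volume.real Q := by rw [hvol]; positivity
  have hne : volume Q ≠ 0 := fun h => by simp [measureReal_def, h] at hvpos
  have hnt : volume Q ≠ ⊤ := by
    rw [hQ.volume_eq]; exact ENNReal.pow_ne_top ENNReal.ofReal_ne_top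
  have hVr : volume Q = ENNReal.ofReal (volume.real Q) := (ENNReal.ofReal_toReal hnt).symm
  have hmean : ENNReal.ofReal (meanOsc Q f) * volume Q
      = ∫⁻ x in Q, ‖f x - ⨍ y in Q, f y‖ₑ := by
    have hint : IntegrableOn (fun x => f x - ⨍ y in Q, f y) Q := hQ.integrableOn (by fun_prop)
    rw [← ofReal_integral_norm_eq_lintegral_enorm hint, hVr, meanOsc,
      mul_comm, ← ENNReal.ofReal_mul hvpos.le]
    congr 1
    generalize ⨍ y in Q, f y = cf
    rw [setAverage_eq, smul_eq_mul, mul_inv_cancel_left₀ hvpos.ne']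
    rfl
  have hpt : ∀ x, volume Q * ‖f x - ⨍ y in Q, f y‖ₑ ≤ ∫⁻ y in Q, ‖f x - f y‖ₑ := fun x => by
    refine le_trans (le_of_eq ?_) (enorm_integral_le_lintegral_enorm _)
    rw [integral_sub (hQ.integrableOn continuous_const) (hQ.integrableOn hfc), setIntegral_const,
      setAverage_eq, hVr, ← Real.enorm_of_nonneg hvpos.le, ← enorm_mul]
    simp only [smul_eq_mul]
    congr 1
    field_simp
  have hdouble : volume Q * ∫⁻ x in Q, ‖f x - ⨍ y in Q, f y‖ₑ
      ≤ volume Q * (ENNReal.ofReal (√n * ε) * 2 ^ n * ∫⁻ x in Q, ‖fderiv ℝ f x‖ₑ) := by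
    have hstep : volume Q * ∫⁻ x in Q, ‖f x - ⨍ y in Q, f y‖ₑ
        ≤ ∫⁻ x in Q, ∫⁻ y in Q, ENNReal.ofReal (√n * ε) * ∫⁻ t in Set.Icc (0 : ℝ) 1,
          ‖fderiv ℝ f ((1 - t) • y + t • x)‖ₑ := by
      rw [← lintegral_const_mul _ (by fun_prop)]
      refine setLIntegral_mono' hQm fun x hx => (hpt x).trans ?_
      refine setLIntegral_mono' hQm fun y hy => (enorm_sub_le_lintegral_segment hf x y).trans ?_
      gcongr
      rw [← ofReal_norm, ← dist_eq_norm]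
      exact ENNReal.ofReal_le_ofReal (hQ.dist_le hx hy)
    refine hstep.trans ?_
    simp_rw [lintegral_const_mul' _ _ ENNReal.ofReal_ne_top]
    calc _ ≤ ENNReal.ofReal (√n * ε) * (2 ^ n * (∫⁻ x in Q, ‖fderiv ℝ f x‖ₑ) * volume Q) := by
          gcongr
          exact hQ.convex.lintegral_segment_le hQm
            (g := fun z => ‖fderiv ℝ f z‖ₑ) (Continuous.measurable (by fun_prop))
      _ = _ := by ring
  rw [hmean]
  exact (ENNReal.mul_le_mul_iff_right hne hnt).1 hdouble

section Local

variable {n : ℕ} {ε : ℝ} {Q : Set (EuclideanSpace ℝ (Fin n))}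
  {f : EuclideanSpace ℝ (Fin n) → ℝ}

/-- The measure with density `|∇f| / 4`. -/
def gradMeasure (f : EuclideanSpace ℝ (Fin n) → ℝ) : Measure (EuclideanSpace ℝ (Fin n)) :=
  volume.withDensity fun x => ENNReal.ofReal (‖fderiv ℝ f x‖ / 4)

theorem gradMeasure_univ (f : EuclideanSpace ℝ (Fin n) → ℝ) :
    gradMeasure f Set.univ = (∫⁻ x, ENNReal.ofReal ‖fderiv ℝ f x‖) / 4 := by
  rw [gradMeasure, withDensity_apply _ MeasurableSet.univ, Measure.restrict_univ, div_eq_mul_inv,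
    ← lintegral_mul_const' _ _ (by simp)]
  congr 1; ext x
  rw [ENNReal.ofReal_div_of_pos (by norm_num), div_eq_mul_inv]
  simp

theorem IsCube.energy_eq (hQ : IsCube n ε Q) (hn : n ≠ 0) (hε : 0 < ε)
    (f : EuclideanSpace ℝ (Fin n) → ℝ) :
    ENNReal.ofReal (ε ^ (n - 1)) * ENNReal.ofReal (meanOsc Q f)
      = ENNReal.ofReal (meanOsc Q f / ε) * volume Q := by
  rw [hQ.volume_eq, ← ENNReal.ofReal_pow hε.le, ← ENNReal.ofReal_mul (by positivity),
    ← ENNReal.ofReal_mul' (by positivity)]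
  congr 1
  obtain ⟨m, rfl⟩ := Nat.exists_eq_succ_of_ne_zero hn
  simp only [Nat.succ_eq_add_one, Nat.add_sub_cancel]
  field_simp
  ring

theorem IsCube.abs_sub_linear_le (hQ : IsCube n ε Q) (hf : ContDiff ℝ 1 f)
    {L : EuclideanSpace ℝ (Fin n) →L[ℝ] ℝ} {η : ℝ} (hη : 0 ≤ η)
    (hL : ∀ x ∈ Q, ‖fderiv ℝ f x - L‖ ≤ η) :
    ∀ x ∈ Q, ∀ y ∈ Q, |(f x - L x) - (f y - L y)| ≤ η * (√n * ε) := by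
  intro x hx y hy
  have h := hQ.convex.norm_image_sub_le_of_norm_fderiv_le'
    (fun z _ => hf.differentiable (by norm_num) z) hL hy hx
  rw [map_sub, Real.norm_eq_abs, ← dist_eq_norm] at h
  rw [show (f x - L x) - (f y - L y) = f x - f y - (L x - L y) by ring]
  exact h.trans (by gcongr; exact hQ.dist_le hx hy)

theorem IsCube.energy_le_of_near_linear (hQ : IsCube n ε Q) (hn : n ≠ 0) (hε : 0 < ε)
    (hf : ContDiff ℝ 1 f) {L : EuclideanSpace ℝ (Fin n) →L[ℝ] ℝ} {η : ℝ} (hη : 0 ≤ η)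
    (hL : ∀ x ∈ Q, ‖fderiv ℝ f x - L‖ ≤ η) :
    ENNReal.ofReal (ε ^ (n - 1)) * ENNReal.ofReal (meanOsc Q f)
      ≤ gradMeasure f Q + ENNReal.ofReal (η * (√n + 1)) * volume Q := by
  have h1 := hQ.meanOsc_sub_le hε hf.continuous L.continuous (hQ.abs_sub_linear_le hf hη hL)
  have h2 := hQ.meanOsc_linear_le hε L
  have h3 : ENNReal.ofReal ((‖L‖ - η) / 4) * volume Q ≤ gradMeasure f Q := by
    rw [gradMeasure, withDensity_apply _ hQ.isOpen.measurableSet, ← setLIntegral_const]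
    refine setLIntegral_mono' hQ.isOpen.measurableSet fun x hx => ENNReal.ofReal_le_ofReal ?_
    have := norm_sub_norm_le L (fderiv ℝ f x)
    rw [norm_sub_rev] at this
    linarith [hL x hx]
  rw [hQ.energy_eq hn hε]
  refine le_trans ?_ (add_le_add_left h3 _)
  rw [← add_mul]
  gcongr
  refine le_trans (ENNReal.ofReal_le_ofReal ?_) ENNReal.ofReal_add_le
  rw [div_le_iff₀ hε]
  nlinarith [mul_nonneg hη hε.le]

theorem gradMeasure_le_of_near_linear (hn : n ≠ 0) (hε : 0 < ε) (hf : ContDiff ℝ 1 f)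
    {i₀ : Fin n} (T : EuclideanSpace ℝ (Fin n) ≃ᵃⁱ[ℝ] EuclideanSpace ℝ (Fin n))
    {L : EuclideanSpace ℝ (Fin n) →L[ℝ] ℝ}
    (hT : ∀ x, L (T.linearIsometryEquiv x) = ‖L‖ * x i₀) {η : ℝ} (hη : 0 ≤ η)
    (hQT : Q = T '' centredCube n (ε / 2)) (hL : ∀ x ∈ Q, ‖fderiv ℝ f x - L‖ ≤ η) :
    gradMeasure f Q ≤ ENNReal.ofReal (ε ^ (n - 1)) * ENNReal.ofReal (meanOsc Q f)
      + ENNReal.ofReal (η * (√n + 1)) * volume Q := by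
  have hQ : IsCube n ε Q := hQT ▸ isCube_image ε T
  have h1 := hQ.meanOsc_sub_le hε L.continuous hf.continuous (c := η * (√n * ε))
    fun x hx y hy => by
      have := hQ.abs_sub_linear_le hf hη hL x hx y hy
      rwa [← abs_neg, show -((L x - f x) - (L y - f y)) = (f x - L x) - (f y - L y) by ring]
  have h2 : meanOsc Q L = ε / 4 * ‖L‖ := hQT ▸ meanOsc_linear_aligned hε T hT
  have h3 : gradMeasure f Q ≤ ENNReal.ofReal ((‖L‖ + η) / 4) * volume Q := by
    rw [gradMeasure, withDensity_apply _ hQ.isOpen.measurableSet, ← setLIntegral_const]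
    refine setLIntegral_mono' hQ.isOpen.measurableSet fun x hx => ENNReal.ofReal_le_ofReal ?_
    have := norm_sub_norm_le (fderiv ℝ f x) L
    linarith [hL x hx]
  rw [hQ.energy_eq hn hε]
  refine h3.trans ?_
  rw [← add_mul]
  gcongr
  refine le_trans (ENNReal.ofReal_le_ofReal ?_) ENNReal.ofReal_add_le
  rw [h2] at h1
  have h4 : ‖L‖ / 4 ≤ meanOsc Q f / ε + η * √n := by
    rw [← sub_le_iff_le_add, le_div_iff₀ hε]
    nlinarith
  nlinarith

theorem IsCube.energy_le_poincare (hQ : IsCube n ε Q) (hn : n ≠ 0) (hε : 0 < ε)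
    (hf : ContDiff ℝ 1 f) :
    ENNReal.ofReal (ε ^ (n - 1)) * ENNReal.ofReal (meanOsc Q f)
      ≤ ENNReal.ofReal √n * 2 ^ n * 4 * gradMeasure f Q := by
  have h := hQ.poincare hε hf
  have h4 : ∫⁻ x in Q, ‖fderiv ℝ f x‖ₑ = 4 * gradMeasure f Q := by
    rw [gradMeasure, withDensity_apply _ hQ.isOpen.measurableSet,
      ← lintegral_const_mul' _ _ (by simp)]
    congr 1; ext x
    rw [show (4 : ℝ≥0∞) = ENNReal.ofReal 4 by simp, ← ENNReal.ofReal_mul (by norm_num),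
      mul_div_cancel₀ _ (by norm_num), ofReal_norm]
  rw [h4, ENNReal.ofReal_mul (by positivity)] at h
  have hε0 : ENNReal.ofReal ε ≠ 0 := by simpa using hε
  rw [hQ.energy_eq hn hε, ← ENNReal.mul_le_mul_iff_right hε0 ENNReal.ofReal_ne_top, ← mul_assoc,
    ← ENNReal.ofReal_mul hε.le, mul_div_cancel₀ _ hε.ne']
  refine h.trans (le_of_eq ?_)
  ring

theorem K_le_of_forall_isCube_le (μ : Measure (EuclideanSpace ℝ (Fin n)))
    (hμ : ∀ Q, IsCube n ε Q →
      ENNReal.ofReal (ε ^ (n - 1)) * ENNReal.ofReal (meanOsc Q f) ≤ μ Q) :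
    K n ε f ≤ μ Set.univ := by
  refine iSup_le fun H => iSup_le fun hHc => iSup_le fun hH => iSup_le fun hHd => ?_
  rw [← ENNReal.tsum_mul_left]
  refine (ENNReal.tsum_le_tsum fun Q : H => hμ Q (hH Q Q.2)).trans ?_
  have := hHc.to_subtype
  rw [← measure_iUnion (fun Q Q' hne => hHd Q.2 Q'.2 (Subtype.coe_injective.ne hne))
    fun Q : H => (hH Q Q.2).isOpen.measurableSet]
  exact measure_mono (Set.subset_univ _)

theorem exists_uniform_fderiv (hf : ContDiff ℝ 1 f) (R : ℝ) {η : ℝ} (hη : 0 < η) :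
    ∃ δ > 0, ∀ x ∈ Metric.ball (0 : EuclideanSpace ℝ (Fin n)) R, ∀ y ∈ Metric.ball 0 R,
      dist x y < δ → ‖fderiv ℝ f x - fderiv ℝ f y‖ ≤ η := by
  have hcont : Continuous (fderiv ℝ f) := hf.continuous_fderiv (by norm_num)
  obtain ⟨δ, hδ, h⟩ := Metric.uniformContinuousOn_iff.1
    ((isCompact_closedBall (0 : EuclideanSpace ℝ (Fin n)) R).uniformContinuousOn_of_continuous
      hcont.continuousOn) η hη
  refine ⟨δ, hδ, fun x hx y hy hxy => ?_⟩
  rw [← dist_eq_norm]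
  exact (h x (Metric.ball_subset_closedBall hx) y (Metric.ball_subset_closedBall hy) hxy).le

theorem eventually_sqrt_mul_lt (n : ℕ) {δ : ℝ} (hδ : 0 < δ) :
    ∀ᶠ ε in 𝓝[>] (0 : ℝ), √n * ε < δ := by
  have : Tendsto (fun ε : ℝ => √n * ε) (𝓝[>] 0) (𝓝 (√n * 0)) :=
    (tendsto_id.const_mul _).mono_left nhdsWithin_le_nhds
  rw [mul_zero] at this
  exact this.eventually_lt_const hδ

theorem exists_pos_add_ofReal_mul_lt {a b v : ℝ≥0∞} (hab : a < b) (hv : v ≠ ⊤) (c : ℝ) :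
    ∃ η > 0, a + ENNReal.ofReal (η * c) * v < b := by
  have h : Tendsto (fun η : ℝ => a + ENNReal.ofReal (η * c) * v) (𝓝[>] 0) (𝓝 (a + 0 * v)) := by
    refine Tendsto.const_add _ (ENNReal.Tendsto.mul_const ?_ (Or.inr hv))
    have h0 : Tendsto (fun η : ℝ => η * c) (𝓝[>] 0) (𝓝 (0 * c)) :=
      (tendsto_id.mul_const _).mono_left nhdsWithin_le_nhds
    simpa using ENNReal.tendsto_ofReal h0
  rw [zero_mul, add_zero] at h
  obtain ⟨η, h1, h2⟩ := ((h.eventually_lt_const hab).and self_mem_nhdsWithin).exists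
  exact ⟨η, h2, h1⟩

theorem eventually_K_lt (hn : n ≠ 0) (hf : ContDiff ℝ 1 f) {b : ℝ≥0∞}
    (hb : gradMeasure f Set.univ < b) : ∀ᶠ ε in 𝓝[>] (0 : ℝ), K n ε f < b := by
  set C : ℝ≥0∞ := ENNReal.ofReal √n * 2 ^ n * 4 with hC
  have hCt : C ≠ ⊤ := by finiteness
  obtain ⟨R, hR⟩ : ∃ R : ℕ, gradMeasure f Set.univ
      + C * gradMeasure f (Metric.ball (0 : EuclideanSpace ℝ (Fin n)) R)ᶜ < b := by
    have h1 : Tendsto (fun m : ℕ => gradMeasure f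
        (Metric.ball (0 : EuclideanSpace ℝ (Fin n)) m)ᶜ) atTop (𝓝 0) := by
      have h := tendsto_measure_iInter_atTop (μ := gradMeasure f)
        (s := fun m : ℕ => (Metric.ball (0 : EuclideanSpace ℝ (Fin n)) m)ᶜ)
        (fun m => Metric.isOpen_ball.measurableSet.compl.nullMeasurableSet)
        (fun m m' hm => Set.compl_subset_compl.2 (Metric.ball_subset_ball (by exact_mod_cast hm)))
        ⟨0, (lt_of_le_of_lt (measure_mono (Set.subset_univ _))
          (hb.trans_le le_top)).ne⟩
      rwa [← Set.compl_iUnion, Metric.iUnion_ball_nat, Set.compl_univ, measure_empty] at h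
    have h2 := (ENNReal.Tendsto.const_mul h1 (Or.inr hCt)).const_add
      (gradMeasure f Set.univ)
    rw [mul_zero, add_zero] at h2
    exact (h2.eventually_lt_const hb).exists
  obtain ⟨η, hη, hηb⟩ := exists_pos_add_ofReal_mul_lt hR
    (measure_ball_lt_top (μ := volume) (x := (0 : EuclideanSpace ℝ (Fin n)))
      (r := (R : ℝ) + 1)).ne (√n + 1)
  obtain ⟨δ, hδ, hunif⟩ := exists_uniform_fderiv hf (R + 1) hη
  filter_upwards [eventually_sqrt_mul_lt n hδ, eventually_sqrt_mul_lt n one_pos,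
    self_mem_nhdsWithin] with ε hεδ hε1 hε
  refine lt_of_le_of_lt ?_ hηb
  have hK := K_le_of_forall_isCube_le (ε := ε) (f := f) (gradMeasure f
    + C • (gradMeasure f).restrict (Metric.ball (0 : EuclideanSpace ℝ (Fin n)) R)ᶜ
    + ENNReal.ofReal (η * (√n + 1)) • volume.restrict
      (Metric.ball (0 : EuclideanSpace ℝ (Fin n)) (R + 1))) fun Q hQ => ?_
  · simpa using hK
  simp only [Measure.add_apply, Measure.smul_apply, smul_eq_mul,
    Measure.restrict_apply hQ.isOpen.measurableSet]
  by_cases hmeet : ∃ z ∈ Q, z ∈ Metric.ball (0 : EuclideanSpace ℝ (Fin n)) R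
  · obtain ⟨z, hzQ, hz⟩ := hmeet
    have hsub : Q ⊆ Metric.ball (0 : EuclideanSpace ℝ (Fin n)) (R + 1) := fun x hx => by
      have h1 := hQ.dist_le hx hzQ
      have h2 := dist_triangle x z 0
      rw [Metric.mem_ball] at hz ⊢
      linarith
    rw [Set.inter_eq_left.2 hsub]
    refine (hQ.energy_le_of_near_linear hn hε hf hη.le (L := fderiv ℝ f z) fun x hx =>
      hunif x (hsub hx) z (hsub hzQ) ((hQ.dist_le hx hzQ).trans_lt hεδ)).trans ?_
    gcongr
    exact le_self_add
  · have hsub : Q ⊆ (Metric.ball (0 : EuclideanSpace ℝ (Fin n)) R)ᶜ := fun x hx hx' =>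
      hmeet ⟨x, hx, hx'⟩
    rw [Set.inter_eq_left.2 hsub]
    refine (hQ.energy_le_poincare hn hε hf).trans ?_
    rw [← hC]
    exact le_add_right le_add_self

end Local

section Grid

variable {n : ℕ}

/-- The rigid motion `x ↦ S (x + ε k)`. -/
def gridMotion (S : EuclideanSpace ℝ (Fin n) ≃ₗᵢ[ℝ] EuclideanSpace ℝ (Fin n)) (ε : ℝ)
    (k : Fin n → ℤ) : EuclideanSpace ℝ (Fin n) ≃ᵃⁱ[ℝ] EuclideanSpace ℝ (Fin n) :=
  (AffineIsometryEquiv.constVAdd ℝ (EuclideanSpace ℝ (Fin n))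
    (WithLp.toLp 2 fun i => ε * k i)).trans S.toAffineIsometryEquiv

/-- The cubes of the grid of mesh `ε` in the frame given by `S`. -/
def gridCube (S : EuclideanSpace ℝ (Fin n) ≃ₗᵢ[ℝ] EuclideanSpace ℝ (Fin n)) (ε : ℝ)
    (k : Fin n → ℤ) : Set (EuclideanSpace ℝ (Fin n)) :=
  gridMotion S ε k '' centredCube n (ε / 2)

theorem gridMotion_linear (S : EuclideanSpace ℝ (Fin n) ≃ₗᵢ[ℝ] EuclideanSpace ℝ (Fin n))
    (ε : ℝ) (k : Fin n → ℤ) : (gridMotion S ε k).linearIsometryEquiv = S := by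
  ext x
  rfl

theorem isCube_gridCube (S : EuclideanSpace ℝ (Fin n) ≃ₗᵢ[ℝ] EuclideanSpace ℝ (Fin n))
    (ε : ℝ) (k : Fin n → ℤ) : IsCube n ε (gridCube S ε k) :=
  isCube_image ε _

theorem mem_gridCube {S : EuclideanSpace ℝ (Fin n) ≃ₗᵢ[ℝ] EuclideanSpace ℝ (Fin n)} {ε : ℝ}
    {k : Fin n → ℤ} {y : EuclideanSpace ℝ (Fin n)} :
    y ∈ gridCube S ε k ↔ ∀ i, |S.symm y i - ε * k i| < ε / 2 := by
  have hmot : ∀ x, gridMotion S ε k x = S (WithLp.toLp 2 (fun i => ε * (k i : ℝ)) + x) :=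
    fun x => rfl
  constructor
  · rintro ⟨x, hx, rfl⟩ i
    rw [hmot, LinearIsometryEquiv.symm_apply_apply, PiLp.add_apply, add_sub_cancel_left]
    exact abs_lt.2 (hx i)
  · intro hy
    refine ⟨S.symm y - WithLp.toLp 2 (fun i => ε * (k i : ℝ)), fun i => ?_, ?_⟩
    · rw [PiLp.sub_apply]
      exact abs_lt.1 (hy i)
    · rw [hmot, add_sub_cancel, LinearIsometryEquiv.apply_symm_apply]

theorem disjoint_gridCube {S : EuclideanSpace ℝ (Fin n) ≃ₗᵢ[ℝ] EuclideanSpace ℝ (Fin n)}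
    {ε : ℝ} (hε : 0 < ε) {k l : Fin n → ℤ} (hkl : k ≠ l) :
    Disjoint (gridCube S ε k) (gridCube S ε l) := by
  rw [Set.disjoint_left]
  intro y hk hl
  rw [mem_gridCube] at hk hl
  refine hkl (funext fun i => ?_)
  have h1 := abs_lt.1 (hk i)
  have h2 := abs_lt.1 (hl i)
  have h3 : ε * ((k i : ℝ) - l i) < ε * 1 := by linarith
  have h4 : ε * ((l i : ℝ) - k i) < ε * 1 := by linarith
  have h5 := lt_of_mul_lt_mul_left h3 hε.le
  have h6 := lt_of_mul_lt_mul_left h4 hε.le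
  have h7 : k i - l i < 1 := by exact_mod_cast h5
  have h8 : l i - k i < 1 := by exact_mod_cast h6
  omega

theorem ae_exists_mem_gridCube
    (S : EuclideanSpace ℝ (Fin n) ≃ₗᵢ[ℝ] EuclideanSpace ℝ (Fin n)) {ε : ℝ} (hε : 0 < ε) :
    ∀ᵐ y, ∃ k, y ∈ gridCube S ε k := by
  have hae : ∀ᵐ y, ∀ (i : Fin n) (m : ℤ), S.symm y i ≠ ε * m + ε / 2 ∧
      S.symm y i ≠ ε * m - ε / 2 := by
    rw [ae_all_iff]; intro i
    rw [ae_all_iff]; intro m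
    have hq : Measure.QuasiMeasurePreserving
        (fun y : EuclideanSpace ℝ (Fin n) => S.symm y i) volume volume :=
      (Measure.quasiMeasurePreserving_eval (fun _ : Fin n => (volume : Measure ℝ)) i).comp
        ((PiLp.volume_preserving_ofLp (Fin n)).comp
          S.symm.measurePreserving).quasiMeasurePreserving
    exact (hq.ae (Measure.ae_ne volume _)).and (hq.ae (Measure.ae_ne volume _))
  filter_upwards [hae] with y hy
  refine ⟨fun i => round (S.symm y i / ε), mem_gridCube.2 fun i => ?_⟩
  have h1 := abs_le.1 (abs_sub_round (S.symm y i / ε))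
  obtain ⟨h2, h3⟩ := hy i (round (S.symm y i / ε))
  set m : ℝ := (round (S.symm y i / ε) : ℝ)
  have h4 : S.symm y i = ε * (S.symm y i / ε) := by field_simp
  rw [abs_lt]
  constructor
  · refine lt_of_le_of_ne ?_ fun h => h3 (by linarith)
    nlinarith [h1.1]
  · refine lt_of_le_of_ne ?_ fun h => h2 (by linarith)
    nlinarith [h1.2]

end Grid

section Lower

variable {n : ℕ} {f : EuclideanSpace ℝ (Fin n) → ℝ}

theorem gradMeasure_le_K_add {ε c : ℝ} (hε : 0 < ε)
    {A : (Fin n → ℤ) → Set (EuclideanSpace ℝ (Fin n))} (hA : Pairwise (Function.onFun Disjoint A))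
    (S : (Fin n → ℤ) → EuclideanSpace ℝ (Fin n) ≃ₗᵢ[ℝ] EuclideanSpace ℝ (Fin n))
    (hS : ∀ j k, gridCube (S j) ε k ⊆ A j → gradMeasure f (gridCube (S j) ε k)
      ≤ ENNReal.ofReal (ε ^ (n - 1)) * ENNReal.ofReal (meanOsc (gridCube (S j) ε k) f)
        + ENNReal.ofReal c * volume (gridCube (S j) ε k)) :
    gradMeasure f {x | ∃ j, Metric.closedBall x (√n * ε) ⊆ A j}
      ≤ K n ε f + ENNReal.ofReal c * volume (⋃ j, A j) := by
  set H : Set (Set (EuclideanSpace ℝ (Fin n))) :=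
    {Q | ∃ j k, Q = gridCube (S j) ε k ∧ Q ⊆ A j} with hH
  have hHc : H.Countable := by
    refine (Set.countable_range fun p : (Fin n → ℤ) × (Fin n → ℤ) =>
      gridCube (S p.1) ε p.2).mono ?_
    rintro Q ⟨j, k, rfl, -⟩
    exact ⟨(j, k), rfl⟩
  have hHcube : ∀ Q ∈ H, IsCube n ε Q := by
    rintro Q ⟨j, k, rfl, -⟩
    exact isCube_gridCube _ _ _
  have hHd : H.Pairwise Disjoint := by
    rintro Q ⟨j, k, rfl, hj⟩ Q' ⟨j', k', rfl, hj'⟩ hne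
    rcases eq_or_ne j j' with rfl | hjj
    · exact disjoint_gridCube hε fun h => hne (by rw [h])
    · exact (hA hjj).mono hj hj'
  have := hHc.to_subtype
  have hunion : ∀ μ : Measure (EuclideanSpace ℝ (Fin n)), μ (⋃ Q : H, (Q : Set _))
      = ∑' Q : H, μ Q := fun μ =>
    measure_iUnion (fun Q Q' hne => hHd Q.2 Q'.2 (Subtype.coe_injective.ne hne))
      fun Q : H => (hHcube Q Q.2).isOpen.measurableSet
  have hK : ∑' Q : H, ENNReal.ofReal (ε ^ (n - 1)) * ENNReal.ofReal (meanOsc (Q : Set _) f)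
      ≤ K n ε f := by
    rw [ENNReal.tsum_mul_left]
    exact le_iSup_of_le H <| le_iSup_of_le hHc <| le_iSup_of_le hHcube <|
      le_iSup_of_le hHd le_rfl
  calc gradMeasure f {x | ∃ j, Metric.closedBall x (√n * ε) ⊆ A j}
      ≤ gradMeasure f (⋃ Q : H, (Q : Set _)) := by
        apply measure_mono_ae
        have hae : ∀ᵐ y, ∀ j, ∃ k, y ∈ gridCube (S j) ε k :=
          ae_all_iff.2 fun j => ae_exists_mem_gridCube (S j) hε
        filter_upwards [(withDensity_absolutelyContinuous volume _).ae_le hae] with x hx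
        rintro ⟨j, hj⟩
        obtain ⟨k, hk⟩ := hx j
        refine Set.mem_iUnion.2 ⟨⟨gridCube (S j) ε k, j, k, rfl, fun y hy => hj ?_⟩, hk⟩
        exact (isCube_gridCube (S j) ε k).dist_le hy hk
    _ = ∑' Q : H, gradMeasure f Q := hunion _
    _ ≤ ∑' Q : H, (ENNReal.ofReal (ε ^ (n - 1)) * ENNReal.ofReal (meanOsc (Q : Set _) f)
        + ENNReal.ofReal c * volume (Q : Set (EuclideanSpace ℝ (Fin n)))) := by
        refine ENNReal.tsum_le_tsum ?_
        rintro ⟨Q, j, k, rfl, hj⟩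
        exact hS j k hj
    _ = (∑' Q : H, ENNReal.ofReal (ε ^ (n - 1)) * ENNReal.ofReal (meanOsc (Q : Set _) f))
        + ENNReal.ofReal c * volume (⋃ Q : H, (Q : Set (EuclideanSpace ℝ (Fin n)))) := by
        rw [ENNReal.tsum_add, ENNReal.tsum_mul_left (a := ENNReal.ofReal c), hunion]
    _ ≤ K n ε f + ENNReal.ofReal c * volume (⋃ j, A j) := by
        gcongr
        refine Set.iUnion_subset ?_
        rintro ⟨Q, j, k, rfl, hj⟩
        exact hj.trans (Set.subset_iUnion A j)

theorem exists_lt_measure_of_eventually_subset {X : Type*} [PseudoMetricSpace X]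
    [MeasurableSpace X] {ι : Type*} (μ : Measure X) {A : ι → Set X} (hA : ∀ j, IsOpen (A j))
    {a : ℝ≥0∞} (ha : a < μ (⋃ j, A j)) :
    ∃ r > 0, ∀ s ≤ r, a < μ {x | ∃ j, Metric.closedBall x s ⊆ A j} := by
  set D : ℝ → Set X := fun r => {x | ∃ j, Metric.closedBall x r ⊆ A j} with hD
  have hanti : Antitone D := fun r s hrs x ⟨j, hj⟩ =>
    ⟨j, (Metric.closedBall_subset_closedBall hrs).trans hj⟩
  have hmono : Monotone fun m : ℕ => D (1 / ((m : ℝ) + 1)) := fun m m' hm =>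
    hanti (Nat.one_div_le_one_div hm)
  have hsub : ⋃ j, A j ⊆ ⋃ m : ℕ, D (1 / ((m : ℝ) + 1)) := by
    intro x hx
    obtain ⟨j, hj⟩ := Set.mem_iUnion.1 hx
    obtain ⟨r, hr, hball⟩ := Metric.isOpen_iff.1 (hA j) x hj
    obtain ⟨m, hm⟩ := exists_nat_one_div_lt hr
    exact Set.mem_iUnion.2 ⟨m, j, (Metric.closedBall_subset_ball hm).trans hball⟩
  have ha' := ha.trans_le (measure_mono hsub)
  rw [hmono.measure_iUnion, lt_iSup_iff] at ha'
  obtain ⟨m, hm⟩ := ha'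
  exact ⟨1 / ((m : ℝ) + 1), by positivity, fun s hs => hm.trans_le (measure_mono (hanti hs))⟩

theorem eventually_lt_K (hn : n ≠ 0) (hf : ContDiff ℝ 1 f) {a : ℝ≥0∞}
    (ha : a < gradMeasure f Set.univ) : ∀ᶠ ε in 𝓝[>] (0 : ℝ), a < K n ε f := by
  obtain ⟨R, hR⟩ : ∃ R : ℕ, a < gradMeasure f (Metric.ball 0 R) := by
    have hmono : Monotone fun m : ℕ => Metric.ball (0 : EuclideanSpace ℝ (Fin n)) m :=
      fun m m' hm => Metric.ball_subset_ball (by exact_mod_cast hm)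
    rw [← Metric.iUnion_ball_nat (0 : EuclideanSpace ℝ (Fin n)), hmono.measure_iUnion,
      lt_iSup_iff] at ha
    exact ha
  have hvol : volume (Metric.ball (0 : EuclideanSpace ℝ (Fin n)) R) ≠ ⊤ :=
    measure_ball_lt_top.ne
  obtain ⟨η, hη, hηR⟩ := exists_pos_add_ofReal_mul_lt hR hvol (√n + 1)
  obtain ⟨δ, hδ, hunif⟩ := exists_uniform_fderiv hf R hη
  obtain ⟨τ, hτδ, hτ⟩ := ((eventually_sqrt_mul_lt n hδ).and self_mem_nhdsWithin).exists
  set A : (Fin n → ℤ) → Set (EuclideanSpace ℝ (Fin n)) := fun j =>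
    gridCube (LinearIsometryEquiv.refl ℝ _) τ j ∩ Metric.ball 0 R with hA
  have hAd : Pairwise (Function.onFun Disjoint A) := fun j j' hjj =>
    (disjoint_gridCube hτ hjj).mono Set.inter_subset_left Set.inter_subset_left
  have hAo : ∀ j, IsOpen (A j) := fun j => (isCube_gridCube _ _ _).isOpen.inter Metric.isOpen_ball
  have hAR : ⋃ j, A j ⊆ Metric.ball 0 R := Set.iUnion_subset fun j => Set.inter_subset_right
  have hfull : gradMeasure f (Metric.ball 0 R) ≤ gradMeasure f (⋃ j, A j) := by
    apply measure_mono_ae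
    filter_upwards [(withDensity_absolutelyContinuous volume _).ae_le
      (ae_exists_mem_gridCube (LinearIsometryEquiv.refl ℝ _) hτ)] with x hx hxR
    obtain ⟨k, hk⟩ := hx
    exact Set.mem_iUnion.2 ⟨k, hk, hxR⟩
  obtain ⟨r, hr, hD⟩ := exists_lt_measure_of_eventually_subset _ hAo (hηR.trans_le hfull)
  let i₀ : Fin n := ⟨0, Nat.pos_of_ne_zero hn⟩
  have hloc : ∀ j, ∃ (S : EuclideanSpace ℝ (Fin n) ≃ₗᵢ[ℝ] EuclideanSpace ℝ (Fin n))
      (L : EuclideanSpace ℝ (Fin n) →L[ℝ] ℝ), (∀ x, L (S x) = ‖L‖ * x i₀) ∧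
        ∀ x ∈ A j, ‖fderiv ℝ f x - L‖ ≤ η := by
    intro j
    obtain ⟨L, hL⟩ : ∃ L : EuclideanSpace ℝ (Fin n) →L[ℝ] ℝ,
        ∀ x ∈ A j, ‖fderiv ℝ f x - L‖ ≤ η := by
      rcases (A j).eq_empty_or_nonempty with h0 | ⟨z, hz⟩
      · exact ⟨0, by simp [h0]⟩
      · exact ⟨fderiv ℝ f z, fun x hx => hunif x hx.2 z hz.2
          (((isCube_gridCube _ _ _).dist_le hx.1 hz.1).trans_lt hτδ)⟩
    obtain ⟨S, hS⟩ := exists_linearIsometryEquiv_aligned i₀ L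
    exact ⟨S, L, hS, hL⟩
  choose S L hSL hL using hloc
  filter_upwards [eventually_sqrt_mul_lt n hr, self_mem_nhdsWithin] with ε hεr hε
  have hmain := gradMeasure_le_K_add (f := f) (c := η * (√n + 1)) hε hAd S fun j k hjk =>
    gradMeasure_le_of_near_linear hn hε hf (gridMotion (S j) ε k) (L := L j) (i₀ := i₀)
      (by rw [gridMotion_linear]; exact hSL j) hη.le rfl fun x hx => hL j x (hjk hx)
  have hlt := (hD _ hεr.le).trans_le (hmain.trans
    (add_le_add_right (mul_le_mul_right (measure_mono hAR) _) _))
  exact lt_of_add_lt_add_right hlt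

end Lower

theorem K_zero_dim (ε : ℝ) (f : EuclideanSpace ℝ (Fin 0) → ℝ) : K 0 ε f = 0 := by
  refine le_antisymm (iSup_le fun H => iSup_le fun _ => iSup_le fun hH => iSup_le fun _ => ?_)
    bot_le
  refine le_of_eq (mul_eq_zero_of_right _ (ENNReal.tsum_eq_zero.2 fun Q => ?_))
  have hv : volume (Q : Set (EuclideanSpace ℝ (Fin 0))) = 1 := by
    simpa using (hH Q Q.2).volume_eq
  have hf : f = fun _ => f 0 := funext fun x => by rw [Subsingleton.elim x 0]
  rw [hf]
  simp [setAverage_eq, measureReal_def, hv]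
/-- Pointwise limit on smooth functions: if `f ∈ C^∞(ℝ^n)` then
`lim_{ε→0} K_ε(f) = (1/4) ∫ |∇f|`, as an equality in `[0,∞]`. -/
theorem stmt17 (n : ℕ) (f : EuclideanSpace ℝ (Fin n) → ℝ) (hf : ContDiff ℝ (⊤ : ℕ∞) f) :
    Tendsto (fun ε => K n ε f) (𝓝[>] (0 : ℝ))
      (𝓝 ((∫⁻ x, ENNReal.ofReal ‖fderiv ℝ f x‖) / 4)) := by

  have hf1 : ContDiff ℝ 1 f := hf.of_le (by exact_mod_cast le_top)
  rw [← gradMeasure_univ]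
  rcases eq_or_ne n 0 with rfl | hn
  · have h0 : gradMeasure f Set.univ = 0 := by
      have : ∀ x, fderiv ℝ f x = 0 := fun x => Subsingleton.elim _ _
      rw [gradMeasure_univ]; simp [this]
    simp [K_zero_dim, h0]
  · exact tendsto_order.2 ⟨fun a ha => eventually_lt_K hn hf1 ha,
      fun b hb => eventually_K_lt hn hf1 hb⟩
end
end
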